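/- arXiv:1107.1878 — 3 statements merged into one kernel-verified Lean document; each statement's English description precedes it below -/
import Mathlib

section
/- The polyiamond T₂,₁ = {(0,0,0),(0,0,1)} has threshold sequence (2,∞): it is a (1,2)-winner, it is a (1,3)-loser, and it is an (n,b)-winner for every n ≥ 2 and every b ∈ ℕ. -/
/-- Cells of the triangular board: `(x, y, u)` with `u = 0` an upward triangle
and `u = 1` a downward triangle. -/
abbrev TriCell : Type := ℤ × ℤ × Fin 2

/-- The downward cell `(x,y,1)` is adjacent exactly to the upward cells
`(x,y,0)`, `(x+1,y,0)` and `(x,y+1,0)`. -/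
def TriAdjacent (p q : TriCell) : Prop :=
  ∃ x y : ℤ,
    (p = (x, y, 1) ∧ (q = (x, y, 0) ∨ q = (x + 1, y, 0) ∨ q = (x, y + 1, 0))) ∨
    (q = (x, y, 1) ∧ (p = (x, y, 0) ∨ p = (x + 1, y, 0) ∨ p = (x, y + 1, 0)))

/-- A polyiamond is a finite nonempty set of cells that is connected under adjacency. -/
def IsPolyiamond (A : Finset TriCell) : Prop :=
  A.Nonempty ∧ ∀ p ∈ A, ∀ q ∈ A,
    Relation.ReflTransGen (fun u v => u ∈ A ∧ v ∈ A ∧ TriAdjacent u v) p q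

/-- Rotation of the triangular tiling by 60 degrees about a vertex,
expressed in these coordinates. -/
def triRot : Function.End TriCell := fun p =>
  if p.2.2 = 0 then (-p.2.1 - 1, p.1 + p.2.1, 1) else (-p.2.1 - 1, p.1 + p.2.1 + 1, 0)

/-- A reflection of the triangular tiling, expressed in these coordinates. -/
def triRefl : Function.End TriCell := fun p => (p.2.1, p.1, p.2.2)

/-- Translations of the triangular tiling. -/
def IsTriTranslation (f : Function.End TriCell) : Prop :=
  ∃ a b : ℤ, f = fun p => (p.1 + a, p.2.1 + b, p.2.2)

/-- The symmetries of the triangular tiling: all compositions of translations,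
rotations by multiples of 60 degrees and reflections.  (Since `triRot` has order 6,
`triRefl` has order 2, and the set of translations is closed under inverses, the
monoid generated by them is the full symmetry group.) -/
def triSymmetries : Submonoid (Function.End TriCell) :=
  Submonoid.closure ({f | IsTriTranslation f} ∪ {triRot, triRefl})

/-- `P` is a placement of the polyiamond `A`: the image of `A` under a symmetry
of the triangular tiling. -/
def IsTriPlacement (A : Finset TriCell) (P : Set TriCell) : Prop :=
  ∃ f ∈ triSymmetries, P = (f : TriCell → TriCell) '' (↑A : Set TriCell)

/-- The maker's move on his `n`-th turn (`0`-indexed), given his strategy `σ`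
(a function of the list of the breaker's previous moves, which together with `σ`
determines the whole history) and the breaker's sequence of moves `β`. -/
def makerMove (σ : List (Finset TriCell) → Finset TriCell) (β : ℕ → Finset TriCell)
    (n : ℕ) : Finset TriCell :=
  σ ((List.range n).map β)

/-- The set of cells marked by the maker after his first `n` turns. -/
def makerMarks (σ : List (Finset TriCell) → Finset TriCell) (β : ℕ → Finset TriCell) :
    ℕ → Finset TriCell
  | 0 => ∅
  | n + 1 => makerMarks σ β n ∪ makerMove σ β n

/-- The set of cells marked by the breaker after her first `n` turns. -/
def breakerMarks (β : ℕ → Finset TriCell) : ℕ → Finset TriCell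
  | 0 => ∅
  | n + 1 => breakerMarks β n ∪ β n

/-- The maker plays legally: on every turn he marks exactly `a` previously unmarked cells. -/
def MakerLegal (a : ℕ) (σ : List (Finset TriCell) → Finset TriCell)
    (β : ℕ → Finset TriCell) : Prop :=
  ∀ n, (makerMove σ β n).card = a ∧
    Disjoint (makerMove σ β n) (makerMarks σ β n ∪ breakerMarks β n)

/-- The breaker plays legally: on every turn she marks exactly `b` previously unmarked
cells (on turn `n` she moves after the maker, so she must avoid `makerMarks σ β (n+1)`). -/
def BreakerLegal (b : ℕ) (σ : List (Finset TriCell) → Finset TriCell)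
    (β : ℕ → Finset TriCell) : Prop :=
  ∀ n, (β n).card = b ∧ Disjoint (β n) (makerMarks σ β (n + 1) ∪ breakerMarks β n)

/-- `A` is an `(a,b)`-winner: the maker has a winning strategy in the weak `(a,b)`
achievement game with goal `A`, i.e. a strategy that always plays legally against any
legal breaker play and eventually marks all cells of some placement of `A`. -/
def IsWinner (A : Finset TriCell) (a b : ℕ) : Prop :=
  ∃ σ : List (Finset TriCell) → Finset TriCell, ∀ β : ℕ → Finset TriCell,
    BreakerLegal b σ β →
      MakerLegal a σ β ∧
        ∃ n, ∃ P : Set TriCell, IsTriPlacement A P ∧ P ⊆ ↑(makerMarks σ β n)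

/-- The polyiamond `T₂,₁`. -/
def T21 : Finset TriCell := {(0, 0, 0), (0, 0, 1)}

theorem aux_ext (X S : Finset TriCell) (n : ℕ) (hd : Disjoint S X) (h : S.card ≤ n) :
    ∃ t : Finset TriCell, S ⊆ t ∧ t.card = n ∧ Disjoint t X := by
  have hc : (S ∪ X).card ≤ n + X.card := by
    rw [Finset.card_union_of_disjoint hd]; omega
  obtain ⟨t, ht, htc⟩ := Infinite.exists_superset_card_eq (S ∪ X) (n + X.card) hc
  have hX : X ⊆ t := Finset.subset_union_right.trans ht
  have hS : S ⊆ t := Finset.subset_union_left.trans ht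
  refine ⟨t \ X, ?_, ?_, Finset.sdiff_disjoint⟩
  · intro x hx
    exact Finset.mem_sdiff.2 ⟨hS hx, Finset.disjoint_left.1 hd hx⟩
  · rw [Finset.card_sdiff_of_subset hX]; omega

def auxStep (F : Finset TriCell → Finset TriCell → Finset TriCell)
    (s : Finset TriCell × Finset TriCell) (b : Finset TriCell) :
    Finset TriCell × Finset TriCell := (s.1 ∪ F s.1 s.2, s.2 ∪ b)

theorem aux_strat (F : Finset TriCell → Finset TriCell → Finset TriCell) :
    ∃ σ : List (Finset TriCell) → Finset TriCell, ∀ β n,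
      makerMove σ β n = F (makerMarks σ β n) (breakerMarks β n) := by
  let st : List (Finset TriCell) → Finset TriCell × Finset TriCell :=
    fun L => L.foldl (auxStep F) (∅, ∅)
  refine ⟨fun L => F (st L).1 (st L).2, fun β n => ?_⟩
  have key : ∀ n, st ((List.range n).map β) =
      (makerMarks (fun L => F (st L).1 (st L).2) β n, breakerMarks β n) := by
    intro n
    induction n with
    | zero => rfl
    | succ n ih =>
      have : st ((List.range (n+1)).map β) = auxStep F (st ((List.range n).map β)) (β n) := by
        simp [st, List.range_succ, List.foldl_append]
      rw [this]
      simp only [auxStep, makerMarks, breakerMarks, makerMove, ih]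
  simp only [makerMove, key]

theorem aux_F (a : ℕ) (S0 : Finset TriCell) (h0 : S0.card = a) (W : Finset TriCell → Prop) :
    ∃ F : Finset TriCell → Finset TriCell → Finset TriCell, F ∅ ∅ = S0 ∧
      (∀ M B, (F M B).card = a ∧ Disjoint (F M B) (M ∪ B)) ∧
      (∀ M B, M.Nonempty → (∃ S : Finset TriCell, S.card = a ∧ Disjoint S (M ∪ B) ∧ W (M ∪ S)) →
        W (M ∪ F M B)) := by
  have : ∀ M B : Finset TriCell, ∃ T : Finset TriCell, (M = ∅ → B = ∅ → T = S0) ∧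
      (T.card = a ∧ Disjoint T (M ∪ B)) ∧
      (M.Nonempty → (∃ S : Finset TriCell, S.card = a ∧ Disjoint S (M ∪ B) ∧ W (M ∪ S)) →
        W (M ∪ T)) := by
    intro M B
    by_cases hM : M = ∅ ∧ B = ∅
    · obtain ⟨rfl, rfl⟩ := hM
      exact ⟨S0, fun _ _ => rfl, ⟨h0, by simp⟩, fun h => by simp at h⟩
    · by_cases hS : ∃ S : Finset TriCell, S.card = a ∧ Disjoint S (M ∪ B) ∧ W (M ∪ S)
      · obtain ⟨S, h1, h2, h3⟩ := hS
        exact ⟨S, fun h h' => absurd ⟨h, h'⟩ hM, ⟨h1, h2⟩, fun _ _ => h3⟩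
      · obtain ⟨t, -, ht, hd⟩ := aux_ext (M ∪ B) ∅ a (by simp) (by simp)
        exact ⟨t, fun h h' => absurd ⟨h, h'⟩ hM, ⟨ht, hd⟩, fun _ h => absurd h hS⟩
  choose F h1 h2 h3 using this
  exact ⟨F, h1 ∅ ∅ rfl rfl, h2, h3⟩

theorem aux_trans (a b : ℤ) :
    (fun p => (p.1 + a, p.2.1 + b, p.2.2) : Function.End TriCell) ∈ triSymmetries :=
  Submonoid.subset_closure (Or.inl ⟨a, b, rfl⟩)

theorem aux_rot : triRot ∈ triSymmetries :=
  Submonoid.subset_closure (Or.inr (by simp))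

theorem aux_refl : triRefl ∈ triSymmetries :=
  Submonoid.subset_closure (Or.inr (by simp))

theorem aux_pl1 : IsTriPlacement T21 {(0, 0, 0), (0, 0, 1)} :=
  ⟨1, one_mem _, by simp [T21, Function.End.one_def]⟩

theorem aux_pl2 : IsTriPlacement T21 {(0, 0, 0), (0, -1, 1)} := by
  refine ⟨_, mul_mem (aux_trans 1 (-1)) aux_rot, ?_⟩
  rw [T21, Finset.coe_pair]
  refine Eq.trans ?_ (Set.image_pair _ _ _).symm
  exact Set.pair_comm _ _

theorem aux_pl3 : IsTriPlacement T21 {(0, 0, 0), (-1, 0, 1)} := by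
  refine ⟨_, mul_mem aux_refl (mul_mem (aux_trans 1 (-1)) aux_rot), ?_⟩
  rw [T21, Finset.coe_pair]
  refine Eq.trans ?_ (Set.image_pair _ _ _).symm
  exact Set.pair_comm _ _

theorem aux_one_two : IsWinner T21 1 2 := by
  obtain ⟨F, hF0, hF, hW⟩ := aux_F 1 {(0, 0, 0)} (by simp)
    (fun M => ∃ P : Set TriCell, IsTriPlacement T21 P ∧ P ⊆ ↑M)
  obtain ⟨σ, hσ⟩ := aux_strat F
  refine ⟨σ, fun β hβ => ⟨fun n => by rw [hσ]; exact hF _ _, 2, ?_⟩⟩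
  have m1 : makerMarks σ β 1 = {(0, 0, 0)} := by
    simp [makerMarks, hσ, breakerMarks, hF0]
  have b1 : breakerMarks β 1 = β 0 := by simp [breakerMarks]
  have m2 : makerMarks σ β 2 = {(0, 0, 0)} ∪ F {(0, 0, 0)} (β 0) := by
    rw [makerMarks, hσ, m1, b1]
  rw [m2]
  apply hW _ _ (by simp)
  have hc := (hβ 0).1
  let N : Finset TriCell := {(0, 0, 1), (0, -1, 1), (-1, 0, 1)}
  have hN : N.card = 3 := by decide
  obtain ⟨c, hcN, hcB⟩ : ∃ c ∈ N, c ∉ β 0 := by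
    by_contra! h
    have := Finset.card_le_card (show N ⊆ β 0 from h)
    omega
  refine ⟨{c}, by simp, ?_, {(0, 0, 0), c}, ?_, ?_⟩
  · simp only [Finset.disjoint_singleton_left, Finset.mem_union, Finset.mem_singleton, not_or]
    refine ⟨?_, hcB⟩
    rintro rfl
    revert hcN; decide
  · simp only [N, Finset.mem_insert, Finset.mem_singleton] at hcN
    rcases hcN with rfl | rfl | rfl
    · exact aux_pl1
    · exact aux_pl2
    · exact aux_pl3
  · simp [Set.insert_subset_iff]

theorem aux_many (n b : ℕ) (hn : 2 ≤ n) : IsWinner T21 n b := by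
  obtain ⟨S0, hS, hc, -⟩ := aux_ext ∅ T21 n (by simp) (by
    have : T21.card = 2 := by decide
    omega)
  obtain ⟨F, hF0, hF, -⟩ := aux_F n S0 hc (fun _ => True)
  obtain ⟨σ, hσ⟩ := aux_strat F
  refine ⟨σ, fun β _ => ⟨fun n => by rw [hσ]; exact hF _ _, 1, ↑T21, ?_, ?_⟩⟩
  · exact ⟨1, one_mem _, by simp [Function.End.one_def]⟩
  · simpa [makerMarks, hσ, breakerMarks, hF0] using hS

def auxNbrs (p : TriCell) : Finset TriCell :=
  if p.2.2 = 0 then {(p.1, p.2.1, 1), (p.1 - 1, p.2.1, 1), (p.1, p.2.1 - 1, 1)}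
  else {(p.1, p.2.1, 0), (p.1 + 1, p.2.1, 0), (p.1, p.2.1 + 1, 0)}

theorem aux_nbrs_card (p : TriCell) : (auxNbrs p).card ≤ 3 := by
  unfold auxNbrs; split_ifs <;> exact Finset.card_le_three

theorem aux_adj_iff (p q : TriCell) : TriAdjacent p q ↔ q ∈ auxNbrs p := by
  obtain ⟨x, y, u⟩ := p
  obtain ⟨z, w, v⟩ := q
  fin_cases u <;> fin_cases v <;>
    simp [TriAdjacent, auxNbrs] <;> grind

theorem aux_adj_symm {p q : TriCell} (h : TriAdjacent p q) : TriAdjacent q p := by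
  obtain ⟨x, y, h⟩ := h
  exact ⟨x, y, h.symm⟩

theorem aux_adj_ne {p : TriCell} : ¬ TriAdjacent p p := by
  rintro ⟨x, y, h⟩
  rcases h with ⟨rfl, h⟩ | ⟨rfl, h⟩ <;> simp at h

theorem aux_sym_adj (f : Function.End TriCell) (hf : f ∈ triSymmetries) :
    ∀ p q : TriCell, TriAdjacent p q → TriAdjacent (f p) (f q) := by
  induction hf using Submonoid.closure_induction with
  | mem f hf =>
    rcases hf with ⟨a, b, rfl⟩ | rfl | rfl
    · rintro ⟨x, y, u⟩ ⟨z, w, v⟩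
      rw [aux_adj_iff, aux_adj_iff]
      fin_cases u <;> fin_cases v <;> simp [auxNbrs] <;> grind
    · rintro ⟨x, y, u⟩ ⟨z, w, v⟩
      rw [aux_adj_iff, aux_adj_iff]
      fin_cases u <;> fin_cases v <;> simp [auxNbrs, triRot] <;> grind
    · rintro ⟨x, y, u⟩ ⟨z, w, v⟩
      rw [aux_adj_iff, aux_adj_iff]
      fin_cases u <;> fin_cases v <;> simp [auxNbrs, triRefl] <;> grind
  | one => exact fun p q h => h
  | mul f g _ _ hf hg => exact fun p q h => hf _ _ (hg _ _ h)

theorem aux_breaker (H : Finset TriCell → Finset TriCell → Finset TriCell → Finset TriCell)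
    (σ : List (Finset TriCell) → Finset TriCell) :
    ∃ β : ℕ → Finset TriCell, ∀ n,
      β n = H (makerMarks σ β (n + 1)) (breakerMarks β n) (makerMove σ β n) := by
  let st : ℕ → List (Finset TriCell) × Finset TriCell × Finset TriCell := fun n =>
    Nat.rec ([], ∅, ∅) (fun _ s => (s.1 ++ [H (s.2.1 ∪ σ s.1) s.2.2 (σ s.1)],
      s.2.1 ∪ σ s.1, s.2.2 ∪ H (s.2.1 ∪ σ s.1) s.2.2 (σ s.1))) n
  let β : ℕ → Finset TriCell := fun n =>
    H ((st n).2.1 ∪ σ (st n).1) (st n).2.2 (σ (st n).1)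
  have hs : ∀ n, st (n + 1) = ((st n).1 ++ [β n], (st n).2.1 ∪ σ (st n).1, (st n).2.2 ∪ β n) :=
    fun n => rfl
  have key : ∀ n, st n = ((List.range n).map β, makerMarks σ β n, breakerMarks β n) := by
    intro n
    induction n with
    | zero => rfl
    | succ n ih =>
      rw [hs, ih]
      simp [List.range_succ, makerMarks, breakerMarks, makerMove]
  refine ⟨β, fun n => ?_⟩
  change H ((st n).2.1 ∪ σ (st n).1) (st n).2.2 (σ (st n).1) = _
  rw [key]
  rfl

theorem aux_lose : ¬ IsWinner T21 1 3 := by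
  rintro ⟨σ, hσ⟩
  have hex : ∀ M B m : Finset TriCell, ∃ T : Finset TriCell,
      (T.card = 3 ∧ Disjoint T (M ∪ B)) ∧ ∀ c, m = {c} → auxNbrs c \ (M ∪ B) ⊆ T := by
    intro M B m
    by_cases hm : ∃ c, m = {c}
    · obtain ⟨c, rfl⟩ := hm
      obtain ⟨t, h1, h2, h3⟩ := aux_ext (M ∪ B) (auxNbrs c \ (M ∪ B)) 3
        Finset.sdiff_disjoint ((Finset.card_le_card Finset.sdiff_subset).trans (aux_nbrs_card c))
      refine ⟨t, ⟨h2, h3⟩, fun d hd => ?_⟩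
      rw [Finset.singleton_inj] at hd
      exact hd ▸ h1
    · obtain ⟨t, -, h2, h3⟩ := aux_ext (M ∪ B) ∅ 3 (by simp) (by simp)
      exact ⟨t, ⟨h2, h3⟩, fun c hc => absurd ⟨c, hc⟩ hm⟩
  choose H hH1 hH2 using hex
  obtain ⟨β, hβ⟩ := aux_breaker H σ
  have hleg : BreakerLegal 3 σ β := fun n => by
    have := hH1 (makerMarks σ β (n + 1)) (breakerMarks β n) (makerMove σ β n)
    rwa [← hβ n] at this
  obtain ⟨hM, n, P, ⟨f, hf, rfl⟩, hP⟩ := hσ β hleg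
  have inv : ∀ n, Disjoint (makerMarks σ β n) (breakerMarks β n) ∧
      ∀ p ∈ makerMarks σ β n, ∀ q, TriAdjacent p q → q ∈ breakerMarks β n := by
    intro n
    induction n with
    | zero => simp [makerMarks]
    | succ n ih =>
      obtain ⟨ih1, ih2⟩ := ih
      obtain ⟨hc, hd⟩ := hM n
      obtain ⟨c, hc⟩ := Finset.card_eq_one.1 hc
      have hb := (hleg n).2
      have hn := hH2 (makerMarks σ β (n + 1)) (breakerMarks β n) (makerMove σ β n) c hc
      rw [← hβ n] at hn
      rw [Finset.disjoint_union_right] at hb hd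
      have hms : makerMarks σ β (n + 1) = makerMarks σ β n ∪ {c} := by rw [makerMarks, hc]
      rw [hc] at hd
      simp only [Finset.disjoint_singleton_left] at hd
      have hbs : breakerMarks β (n + 1) = breakerMarks β n ∪ β n := rfl
      constructor
      · rw [hbs, Finset.disjoint_union_right]
        refine ⟨?_, hb.1.symm⟩
        rw [hms, Finset.disjoint_union_left]
        exact ⟨ih1, by simpa using hd.2⟩
      · intro p hp q hpq
        rw [hbs, Finset.mem_union]
        rw [hms, Finset.mem_union, Finset.mem_singleton] at hp
        rcases hp with hp | rfl
        · exact Or.inl (ih2 p hp q hpq)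
        · by_cases hq : q ∈ breakerMarks β n
          · exact Or.inl hq
          · refine Or.inr (hn ?_)
            rw [Finset.mem_sdiff, Finset.mem_union, hms, Finset.mem_union, Finset.mem_singleton]
            refine ⟨(aux_adj_iff _ _).1 hpq, ?_⟩
            rintro ((h | rfl) | h)
            · exact hd.2 (ih2 q h p (aux_adj_symm hpq))
            · exact aux_adj_ne hpq
            · exact hq h
  have hadj : TriAdjacent (f (0, 0, 1)) (f (0, 0, 0)) :=
    aux_sym_adj f hf _ _ ⟨0, 0, Or.inl ⟨rfl, Or.inl rfl⟩⟩
  have h1 : f (0, 0, 1) ∈ makerMarks σ β n := hP ⟨_, by simp [T21], rfl⟩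
  have h0 : f (0, 0, 0) ∈ makerMarks σ β n := hP ⟨_, by simp [T21], rfl⟩
  exact Finset.disjoint_left.1 (inv n).1 h0 ((inv n).2 _ h1 _ hadj)

/-- `T₂,₁` has threshold sequence `(2, ∞)`: it is a `(1,2)`-winner, a `(1,3)`-loser, and
an `(n,b)`-winner for every `n ≥ 2` and every `b`. -/
theorem T21_threshold :
    IsWinner T21 1 2 ∧ ¬ IsWinner T21 1 3 ∧
    ∀ n b : ℕ, 2 ≤ n → IsWinner T21 n b :=
  ⟨aux_one_two, aux_lose, aux_many⟩
end

section
/- The polyiamond T₄,₂ = {(0,0,0),(0,0,1),(0,1,0),(−1,1,1)} has threshold sequence (0,3,8,∞): it is a (1,0)-winner, a (1,1)-loser, a (2,3)-winner, a (2,4)-loser, a (3,8)-winner, a (3,9)-loser, and an (n,b)-winner for every n ≥ 4 and every b ∈ ℕ. -/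
/-- The polyiamond `T₄,₂`. -/
def T42 : Finset TriCell := {(0, 0, 0), (0, 0, 1), (0, 1, 0), (-1, 1, 1)}

namespace T42aux

/-! ### Generic game lemmas -/

lemma exists_ext (F T0 : Finset TriCell) (h : Disjoint T0 F) (a : ℕ) (ha : T0.card ≤ a) :
    ∃ T : Finset TriCell, T0 ⊆ T ∧ T.card = a ∧ Disjoint T F := by
  obtain ⟨t, ht, hc⟩ := Infinite.exists_superset_card_eq (T0 ∪ F) (a + F.card)
    (by rw [Finset.card_union_of_disjoint h]; omega)
  refine ⟨t \ F, ?_, ?_, Finset.sdiff_disjoint⟩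
  · intro x hx
    rw [Finset.mem_sdiff]
    exact ⟨ht (Finset.mem_union_left _ hx), fun hF => Finset.disjoint_left.mp h hx hF⟩
  · rw [Finset.card_sdiff_of_subset (fun x hx => ht (Finset.mem_union_right _ hx)), hc]; omega

/-- A positional strategy gives a strategy. -/
lemma exists_strategy (f : Finset TriCell → Finset TriCell → Finset TriCell) :
    ∃ σ : List (Finset TriCell) → Finset TriCell, ∀ β n,
      makerMove σ β n = f (makerMarks σ β n) (breakerMarks β n) := by
  let step : Finset TriCell × Finset TriCell → Finset TriCell → Finset TriCell × Finset TriCell :=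
    fun s T => (s.1 ∪ f s.1 s.2, s.2 ∪ T)
  let st : List (Finset TriCell) → Finset TriCell × Finset TriCell :=
    fun L => L.foldl step (∅, ∅)
  let σ : List (Finset TriCell) → Finset TriCell := fun L => f (st L).1 (st L).2
  have key : ∀ β n, st ((List.range n).map β) = (makerMarks σ β n, breakerMarks β n) := by
    intro β n
    induction n with
    | zero => rfl
    | succ n ih =>
      have h1 : st ((List.range (n+1)).map β) = step (st ((List.range n).map β)) (β n) := by
        simp [st, List.range_succ]
      have h2 : makerMove σ β n = f (makerMarks σ β n) (breakerMarks β n) := by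
        show f (st _).1 (st _).2 = _
        rw [ih]
      rw [h1, ih]
      simp only [step, makerMarks, breakerMarks, h2]
  refine ⟨σ, fun β n => ?_⟩
  show f (st _).1 (st _).2 = _
  rw [key]

lemma winner_of_two (a b : ℕ) (S0 : Finset TriCell) (h0 : S0.card = a)
    (h : ∀ B : Finset TriCell, B.card = b → Disjoint B S0 →
      ∃ P : Finset TriCell, IsTriPlacement T42 (P : Set TriCell) ∧ Disjoint (P \ S0) B ∧
        (P \ S0).card ≤ a) : IsWinner T42 a b := by
  classical
  have hf : ∀ M B : Finset TriCell, ∃ T : Finset TriCell,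
      (T.card = a ∧ Disjoint T (M ∪ B)) ∧ (M = ∅ → B = ∅ → T = S0) ∧
      (M = S0 → B.card = b → Disjoint B S0 → (M = ∅ → B = ∅ → False) →
        ∃ P : Finset TriCell, IsTriPlacement T42 (P : Set TriCell) ∧ P ⊆ M ∪ T) := by
    intro M B
    by_cases h1 : M = ∅ ∧ B = ∅
    · exact ⟨S0, ⟨h0, by simp [h1.1, h1.2]⟩, fun _ _ => rfl, fun _ _ _ h => (h h1.1 h1.2).elim⟩
    · by_cases h2 : M = S0 ∧ B.card = b ∧ Disjoint B S0
      · obtain ⟨rfl, hb, hd⟩ := h2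
        obtain ⟨P, hP, hPB, hc⟩ := h B hb hd
        obtain ⟨T, hT, hTc, hTd⟩ := exists_ext (M ∪ B) (P \ M)
          (Finset.disjoint_union_right.mpr ⟨Finset.sdiff_disjoint, hPB⟩) a hc
        refine ⟨T, ⟨hTc, hTd⟩, fun h3 h4 => (h1 ⟨h3, h4⟩).elim, fun _ _ _ _ => ⟨P, hP, ?_⟩⟩
        intro x hx
        by_cases hxM : x ∈ M
        · exact Finset.mem_union_left _ hxM
        · exact Finset.mem_union_right _ (hT (Finset.mem_sdiff.mpr ⟨hx, hxM⟩))
      · obtain ⟨T, -, hTc, hTd⟩ := exists_ext (M ∪ B) ∅ (by simp) a (by simp)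
        exact ⟨T, ⟨hTc, hTd⟩, fun h3 h4 => (h1 ⟨h3, h4⟩).elim,
          fun h3 h4 h5 _ => (h2 ⟨h3, h4, h5⟩).elim⟩
  choose f hf1 hf2 hf3 using hf
  obtain ⟨σ, hσ⟩ := exists_strategy f
  refine ⟨σ, fun β hβ => ⟨fun n => by rw [hσ]; exact hf1 _ _, ?_⟩⟩
  have m1 : makerMarks σ β 1 = S0 := by
    have := hσ β 0
    simp only [makerMarks, breakerMarks] at this ⊢
    rw [this, hf2 _ _ rfl rfl]; simp
  have b1 : breakerMarks β 1 = β 0 := by simp [breakerMarks]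
  have hb := hβ 0
  have hd : Disjoint (β 0) S0 := by
    have h3 := hb.2
    rw [zero_add, m1] at h3
    exact (Finset.disjoint_union_right.mp h3).1
  by_cases he : S0 = ∅ ∧ β 0 = ∅
  · obtain ⟨P, hP, -, hc⟩ := h (β 0) hb.1 hd
    have : P = ∅ := by
      rw [he.1] at hc h0
      simp at hc h0
      rw [← h0] at hc
      simpa using hc
    exact ⟨0, P, hP, by simp [this]⟩
  · obtain ⟨P, hP, hPs⟩ := hf3 S0 (β 0) rfl hb.1 hd (fun x y => he ⟨x, y⟩)
    refine ⟨2, P, hP, ?_⟩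
    have h4 := hσ β 1
    rw [m1, b1] at h4
    have : makerMarks σ β 2 = S0 ∪ f S0 (β 0) := by
      show makerMarks σ β 1 ∪ makerMove σ β 1 = _
      rw [h4, m1]
    rw [this]
    exact_mod_cast hPs

/-! ### Chevrons -/

/-- The neighbour in direction `i`. -/
def D (i : Fin 3) (p : TriCell) : TriCell :=
  if p.2.2 = 0 then
    (if i = 0 then (p.1, p.2.1, 1) else if i = 1 then (p.1 - 1, p.2.1, 1) else (p.1, p.2.1 - 1, 1))
  else
    (if i = 0 then (p.1, p.2.1, 0) else if i = 1 then (p.1 + 1, p.2.1, 0) else (p.1, p.2.1 + 1, 0))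

def chev (p : TriCell) (i j k : Fin 3) : Finset TriCell :=
  {p, D i p, D j (D i p), D k (D j (D i p))}

lemma D_invol (i : Fin 3) (p : TriCell) : D i (D i p) = p := by
  obtain ⟨x, y, u⟩ := p
  fin_cases u <;> fin_cases i <;> simp [D]

lemma rot_D (i : Fin 3) (p : TriCell) : triRot (D i p) = D (i + 2) (triRot p) := by
  obtain ⟨x, y, u⟩ := p
  fin_cases u <;> fin_cases i <;> simp [D, triRot] <;> omega

lemma refl_D (i : Fin 3) (p : TriCell) : triRefl (D i p) = D (-i) (triRefl p) := by
  obtain ⟨x, y, u⟩ := p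
  fin_cases u <;> fin_cases i <;> simp [D, triRefl] <;> decide

def trans (a b : ℤ) : Function.End TriCell := fun p => (p.1 + a, p.2.1 + b, p.2.2)

lemma trans_D (a b : ℤ) (i : Fin 3) (p : TriCell) : trans a b (D i p) = D i (trans a b p) := by
  obtain ⟨x, y, u⟩ := p
  fin_cases u <;> fin_cases i <;> simp [D, trans] <;> omega

lemma img_chev (g : TriCell → TriCell) (s : Fin 3 → Fin 3) (h : ∀ i p, g (D i p) = D (s i) (g p))
    (p : TriCell) (i j k : Fin 3) :
    g '' (chev p i j k : Set TriCell) = (chev (g p) (s i) (s j) (s k) : Set TriCell) := by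
  simp [chev, Set.image_insert_eq, h]

lemma rot_chev (p : TriCell) (i j k : Fin 3) :
    (triRot : TriCell → TriCell) '' (chev p i j k : Set TriCell) =
      (chev (triRot p) (i+2) (j+2) (k+2) : Set TriCell) :=
  img_chev (triRot) (· + 2) rot_D p i j k

lemma refl_chev (p : TriCell) (i j k : Fin 3) :
    (triRefl : TriCell → TriCell) '' (chev p i j k : Set TriCell) =
      (chev (triRefl p) (-i) (-j) (-k) : Set TriCell) :=
  img_chev (triRefl) (- ·) refl_D p i j k

lemma trans_chev (a b : ℤ) (p : TriCell) (i j k : Fin 3) :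
    (trans a b : TriCell → TriCell) '' (chev p i j k : Set TriCell) =
      (chev (trans a b p) i j k : Set TriCell) :=
  img_chev (trans a b) id (trans_D a b) p i j k

lemma T42_eq : T42 = chev (0,0,0) 0 2 1 := by decide

lemma sym_chev (f : Function.End TriCell) (hf : f ∈ triSymmetries) :
    ∀ p i j k, i ≠ j → j ≠ k → i ≠ k → ∃ p' i' j' k', i' ≠ j' ∧ j' ≠ k' ∧ i' ≠ k' ∧
      (f : TriCell → TriCell) '' (chev p i j k : Set TriCell) = (chev p' i' j' k' : Set TriCell) := by
  unfold triSymmetries at hf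
  induction hf using Submonoid.closure_induction with
  | mem f hf =>
    intro p i j k h1 h2 h3
    rcases hf with ⟨a, b, rfl⟩ | rfl | rfl
    · exact ⟨_, i, j, k, h1, h2, h3, trans_chev a b p i j k⟩
    · exact ⟨_, _, _, _, by simpa using h1, by simpa using h2, by simpa using h3, rot_chev p i j k⟩
    · exact ⟨_, _, _, _, by simpa using h1, by simpa using h2, by simpa using h3, refl_chev p i j k⟩
  | one =>
    intro p i j k h1 h2 h3
    exact ⟨p, i, j, k, h1, h2, h3, Set.image_id _⟩
  | mul f g _ _ hf hg =>
    intro p i j k h1 h2 h3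
    obtain ⟨p', i', j', k', h1, h2, h3, e⟩ := hg p i j k h1 h2 h3
    obtain ⟨p'', i'', j'', k'', h1, h2, h3, e'⟩ := hf p' i' j' k' h1 h2 h3
    refine ⟨p'', i'', j'', k'', h1, h2, h3, ?_⟩
    rw [← e', ← e]
    exact Set.image_comp (f : TriCell → TriCell) (g : TriCell → TriCell) _

lemma placement_chev {P : Set TriCell} (h : IsTriPlacement T42 P) :
    ∃ p i j k, i ≠ j ∧ j ≠ k ∧ i ≠ k ∧ P = (chev p i j k : Set TriCell) := by
  obtain ⟨f, hf, rfl⟩ := h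
  rw [T42_eq]
  exact sym_chev f hf _ _ _ _ (by decide) (by decide) (by decide)

lemma placement_image {P : Set TriCell} (h : IsTriPlacement T42 P) (g : Function.End TriCell)
    (hg : g ∈ triSymmetries) : IsTriPlacement T42 ((g : TriCell → TriCell) '' P) := by
  obtain ⟨f, hf, rfl⟩ := h
  exact ⟨g * f, mul_mem hg hf, (Set.image_comp (g : TriCell → TriCell) (f : TriCell → TriCell) _).symm⟩

def Good (i j k : Fin 3) (u : Fin 2) : Prop :=
  ∀ x y : ℤ, IsTriPlacement T42 (chev (x, y, u) i j k : Set TriCell)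

lemma good_base : Good 0 2 1 0 := by
  intro x y
  have h : IsTriPlacement T42 (T42 : Set TriCell) :=
    ⟨1, one_mem _, (Set.image_id _).symm⟩
  have h2 := placement_image h (trans x y)
    (Submonoid.subset_closure (Or.inl ⟨x, y, rfl⟩))
  rw [T42_eq, trans_chev] at h2
  rw [T42_eq]
  simpa [trans] using h2

lemma good_rot {i j k : Fin 3} {u : Fin 2} (h : Good i j k u) :
    Good (i+2) (j+2) (k+2) (1-u) := by
  intro x y
  have hm : triRot ∈ triSymmetries := Submonoid.subset_closure (Or.inr (Or.inl rfl))
  have h1 := placement_image (h (if u = 0 then y + x + 1 else y + x) (-x-1)) _ hm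
  rw [rot_chev] at h1
  convert h1 using 3
  fin_cases u <;> simp [triRot] <;> ring

lemma good_refl {i j k : Fin 3} {u : Fin 2} (h : Good i j k u) :
    Good (-i) (-j) (-k) u := by
  intro x y
  have hm : triRefl ∈ triSymmetries := Submonoid.subset_closure (Or.inr (Or.inr rfl))
  have h1 := placement_image (h y x) _ hm
  rw [refl_chev] at h1
  exact h1

lemma good_rot' {i j k i' j' k' : Fin 3} {u u' : Fin 2} (h : Good i j k u)
    (e : i' = i + 2 ∧ j' = j + 2 ∧ k' = k + 2 ∧ u' = 1 - u) : Good i' j' k' u' := by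
  obtain ⟨rfl, rfl, rfl, rfl⟩ := e
  exact good_rot h

lemma good_refl' {i j k i' j' k' : Fin 3} {u : Fin 2} (h : Good i j k u)
    (e : i' = -i ∧ j' = -j ∧ k' = -k) : Good i' j' k' u := by
  obtain ⟨rfl, rfl, rfl⟩ := e
  exact good_refl h

lemma chev_placement (p : TriCell) (i j k : Fin 3) (h1 : i ≠ j) (h2 : j ≠ k) (h3 : i ≠ k) :
    IsTriPlacement T42 (chev p i j k : Set TriCell) := by
  have g0 := good_base
  have g1 : Good 2 1 0 1 := good_rot' g0 (by decide)
  have g2 : Good 1 0 2 0 := good_rot' g1 (by decide)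
  have g3 : Good 0 2 1 1 := good_rot' g2 (by decide)
  have g4 : Good 2 1 0 0 := good_rot' g3 (by decide)
  have g5 : Good 1 0 2 1 := good_rot' g4 (by decide)
  have r0 : Good 0 1 2 0 := good_refl' g0 (by decide)
  have r1 : Good 1 2 0 1 := good_refl' g1 (by decide)
  have r2 : Good 2 0 1 0 := good_refl' g2 (by decide)
  have r3 : Good 0 1 2 1 := good_refl' g3 (by decide)
  have r4 : Good 1 2 0 0 := good_refl' g4 (by decide)
  have r5 : Good 2 0 1 1 := good_refl' g5 (by decide)
  obtain ⟨x, y, u⟩ := p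
  suffices Good i j k u from this x y
  have hp : ∀ i j k : Fin 3, i ≠ j → j ≠ k → i ≠ k →
      (i = 0 ∧ j = 1 ∧ k = 2) ∨ (i = 0 ∧ j = 2 ∧ k = 1) ∨ (i = 1 ∧ j = 0 ∧ k = 2) ∨
      (i = 1 ∧ j = 2 ∧ k = 0) ∨ (i = 2 ∧ j = 0 ∧ k = 1) ∨ (i = 2 ∧ j = 1 ∧ k = 0) := by decide
  have hu : u = 0 ∨ u = 1 := by omega
  rcases hu with rfl | rfl <;>
    rcases hp i j k h1 h2 h3 with ⟨rfl, rfl, rfl⟩ | ⟨rfl, rfl, rfl⟩ | ⟨rfl, rfl, rfl⟩ |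
      ⟨rfl, rfl, rfl⟩ | ⟨rfl, rfl, rfl⟩ | ⟨rfl, rfl, rfl⟩
  exacts [r0, g0, g2, r4, r2, g4, r3, g3, g5, r1, r5, g1]

/-! ### Losers -/

lemma loser (a b : ℕ) (R : Finset TriCell → Finset TriCell)
    (hR : ∀ S : Finset TriCell, S.card = a → (R S \ S).card ≤ b)
    (H : ∀ p i j k, i ≠ j → j ≠ k → i ≠ k → ∀ (S : ℕ → Finset TriCell),
      (∀ n, (S n).card = a) → ∀ t : TriCell → ℕ, (∀ c ∈ chev p i j k, c ∈ S (t c)) →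
      (∀ c ∈ chev p i j k, ∀ d ∈ chev p i j k, t c < t d → d ∉ R (S (t c))) → False) :
    ¬ IsWinner T42 a b := by
  classical
  rintro ⟨σ, hσ⟩
  -- reply: `M` are the maker's old marks, `S` his new marks, `B` the breaker's marks
  have hg : ∀ M S B : Finset TriCell, ∃ T : Finset TriCell,
      (T.card = b ∧ Disjoint T ((M ∪ S) ∪ B)) ∧
      (S.card = a → R S ⊆ (M ∪ S) ∪ (B ∪ T)) := by
    intro M S B
    by_cases hS : S.card = a
    · obtain ⟨T, hT, hTc, hTd⟩ := exists_ext ((M ∪ S) ∪ B) (R S \ ((M ∪ S) ∪ B))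
        Finset.sdiff_disjoint b (le_trans (Finset.card_le_card (by
          intro x; simp only [Finset.mem_sdiff, Finset.mem_union]; tauto)) (hR S hS))
      refine ⟨T, ⟨hTc, hTd⟩, fun _ x hx => ?_⟩
      by_cases hx2 : x ∈ (M ∪ S) ∪ B
      · simp only [Finset.mem_union] at hx2 ⊢; tauto
      · have := hT (Finset.mem_sdiff.mpr ⟨hx, hx2⟩)
        simp only [Finset.mem_union]; tauto
    · obtain ⟨T, -, hTc, hTd⟩ := exists_ext ((M ∪ S) ∪ B) ∅ (by simp) b (by simp)
      exact ⟨T, ⟨hTc, hTd⟩, fun h => (hS h).elim⟩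
  choose g hg1 hg2 using hg
  let st : ℕ → List (Finset TriCell) × Finset TriCell × Finset TriCell := fun n =>
    Nat.rec ([], ∅, ∅) (fun _ s =>
      (s.1 ++ [g s.2.1 (σ s.1) s.2.2], s.2.1 ∪ σ s.1, s.2.2 ∪ g s.2.1 (σ s.1) s.2.2)) n
  let β : ℕ → Finset TriCell := fun n => g (st n).2.1 (σ (st n).1) (st n).2.2
  have hst : ∀ n, st n = ((List.range n).map β, makerMarks σ β n, breakerMarks β n) := by
    intro n
    induction n with
    | zero => rfl
    | succ n ih =>
      have h1 : st (n+1) = ((st n).1 ++ [β n], (st n).2.1 ∪ σ (st n).1, (st n).2.2 ∪ β n) := rfl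
      rw [h1, ih]
      simp [List.range_succ, makerMarks, breakerMarks, makerMove]
  have hβ : ∀ n, β n = g (makerMarks σ β n) (makerMove σ β n) (breakerMarks β n) := by
    intro n
    show g (st n).2.1 (σ (st n).1) (st n).2.2 = _
    rw [hst]; rfl
  have hleg : BreakerLegal b σ β := by
    intro n
    rw [hβ n]
    exact hg1 _ _ _
  obtain ⟨hM, N, P, hP, hPN⟩ := hσ β hleg
  obtain ⟨p, i, j, k, h1, h2, h3, rfl⟩ := placement_chev hP
  have hturn : ∀ n c, c ∈ makerMarks σ β n → ∃ m, c ∈ makerMove σ β m := by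
    intro n
    induction n with
    | zero => intro c hc; simp [makerMarks] at hc
    | succ n ih =>
      intro c hc
      rcases Finset.mem_union.mp hc with hc | hc
      · exact ih c hc
      · exact ⟨n, hc⟩
  have hmono : ∀ m n, m ≤ n → makerMarks σ β m ∪ breakerMarks β m ⊆
      makerMarks σ β n ∪ breakerMarks β n := by
    intro m n hmn
    induction n, hmn using Nat.le_induction with
    | base => exact fun x hx => hx
    | succ n _ ih =>
      refine ih.trans ?_
      intro x
      simp only [makerMarks, breakerMarks, Finset.mem_union]; tauto
  have hex : ∀ c, ∃ m, c ∈ chev p i j k → c ∈ makerMove σ β m := by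
    intro c
    by_cases hc : c ∈ chev p i j k
    · obtain ⟨m, hm⟩ := hturn N c (hPN hc)
      exact ⟨m, fun _ => hm⟩
    · exact ⟨0, fun h => (hc h).elim⟩
  choose t ht using hex
  refine H p i j k h1 h2 h3 (makerMove σ β) (fun n => (hM n).1) t (fun c hc => ht c hc) ?_
  intro c hc d hd hlt hdR
  have h4 := hg2 (makerMarks σ β (t c)) (makerMove σ β (t c)) (breakerMarks β (t c)) (hM _).1 hdR
  rw [← hβ] at h4
  have h5 : d ∈ makerMarks σ β (t d) ∪ breakerMarks β (t d) := hmono (t c + 1) (t d) hlt h4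
  exact Finset.disjoint_left.mp (hM (t d)).2 (ht d hd) h5

lemma D_ne (i : Fin 3) (p : TriCell) : D i p ≠ p := by
  obtain ⟨x, y, u⟩ := p
  fin_cases u <;> fin_cases i <;> simp [D]

lemma DD_ne (i j : Fin 3) (h : i ≠ j) (p : TriCell) : D j (D i p) ≠ p := by
  intro h1
  have h2 : D i p = D j p := by rw [← h1, D_invol, h1]
  revert h2 h
  clear h1
  obtain ⟨x, y, u⟩ := p
  fin_cases u <;> fin_cases i <;> fin_cases j <;> simp [D] <;> omega

lemma D_u (i : Fin 3) (p : TriCell) : (D i p).2.2 ≠ p.2.2 := by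
  obtain ⟨x, y, u⟩ := p
  fin_cases u <;> fin_cases i <;> simp [D]

lemma DDD_ne (i j k : Fin 3) (p : TriCell) : D k (D j (D i p)) ≠ p := by
  intro h
  have h1 := D_u k (D j (D i p))
  have h2 := D_u j (D i p)
  have h3 := D_u i p
  rw [h] at h1
  omega

lemma chev_card (p : TriCell) (i j k : Fin 3) (h1 : i ≠ j) (h2 : j ≠ k) :
    (chev p i j k).card = 4 := by
  have e1 := D_ne i p
  have e2 := D_ne j (D i p)
  have e3 := D_ne k (D j (D i p))
  have e4 := DD_ne i j h1 p
  have e5 := DD_ne j k h2 (D i p)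
  have e6 := DDD_ne i j k p
  unfold chev
  rw [Finset.card_insert_of_notMem, Finset.card_insert_of_notMem, Finset.card_insert_of_notMem,
    Finset.card_singleton]
  · simp [e3.symm]
  · simp [e2.symm, e5.symm]
  · simp [e1.symm, e4.symm, e6.symm]

lemma loser11 : ¬ IsWinner T42 1 1 := by
  refine loser 1 1 (fun S => S.image (D 0)) ?_ ?_
  · intro S hS
    exact (Finset.card_le_card Finset.sdiff_subset).trans (Finset.card_image_le.trans hS.le)
  · intro p i j k h1 h2 h3 S hS t ht hb
    have key : ∀ c, c ∈ chev p i j k → D 0 c ∈ chev p i j k → False := by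
      intro c hc hd
      rcases lt_trichotomy (t c) (t (D 0 c)) with h | h | h
      · exact hb c hc _ hd h (Finset.mem_image_of_mem _ (ht c hc))
      · have hA := ht c hc
        have hB := ht _ hd
        rw [← h] at hB
        exact D_ne 0 c (Finset.card_le_one.mp (hS _).le _ hB _ hA)
      · refine hb _ hd c hc h ?_
        have := Finset.mem_image_of_mem (D 0) (ht _ hd)
        rwa [D_invol] at this
    have h0 : i = 0 ∨ j = 0 ∨ k = 0 := by omega
    rcases h0 with rfl | rfl | rfl
    · exact key p (by simp [chev]) (by simp [chev])
    · exact key (D i p) (by simp [chev]) (by simp [chev])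
    · exact key (D j (D i p)) (by simp [chev]) (by simp [chev])

def nbrs (p : TriCell) : Finset TriCell := {D 0 p, D 1 p, D 2 p}

lemma D_mem_nbrs (i : Fin 3) (p : TriCell) : D i p ∈ nbrs p := by
  fin_cases i <;> simp [nbrs]

lemma loser39 : ¬ IsWinner T42 3 9 := by
  refine loser 3 9 (fun S => S.biUnion nbrs) ?_ ?_
  · intro S hS
    refine (Finset.card_le_card Finset.sdiff_subset).trans ?_
    have := Finset.card_biUnion_le_card_mul S nbrs 3 (fun p _ => Finset.card_le_three)
    omega
  · intro p i j k h1 h2 h3 S hS t ht hb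
    have key : ∀ c m, c ∈ chev p i j k → D m c ∈ chev p i j k → t (D m c) = t c := by
      intro c m hc hd
      rcases lt_trichotomy (t c) (t (D m c)) with h | h | h
      · exact (hb c hc _ hd h (Finset.mem_biUnion.mpr ⟨c, ht c hc, D_mem_nbrs m c⟩)).elim
      · exact h.symm
      · refine (hb _ hd c hc h (Finset.mem_biUnion.mpr ⟨_, ht _ hd, ?_⟩)).elim
        have := D_mem_nbrs m (D m c)
        rwa [D_invol] at this
    have k1 := key p i (by simp [chev]) (by simp [chev])
    have k2 := key (D i p) j (by simp [chev]) (by simp [chev])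
    have k3 := key (D j (D i p)) k (by simp [chev]) (by simp [chev])
    have hsub : chev p i j k ⊆ S (t p) := by
      intro c hc
      have hc' := ht c hc
      have : t c = t p := by
        simp only [chev, Finset.mem_insert, Finset.mem_singleton] at hc
        rcases hc with rfl | rfl | rfl | rfl <;> omega
      rwa [this] at hc'
    have := Finset.card_le_card hsub
    rw [chev_card p i j k h1 h2, hS] at this
    omega

lemma three_not (S : Finset TriCell) (hS : S.card = 2) (p : TriCell) (i j : Fin 3) (h : i ≠ j)
    (h1 : p ∈ S) (h2 : D i p ∈ S) (h3 : D j (D i p) ∈ S) : False := by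
  have h4 : ({p, D i p, D j (D i p)} : Finset TriCell).card = 3 :=
    Finset.card_eq_three.mpr ⟨_, _, _, (D_ne i p).symm, (DD_ne i j h p).symm,
      (D_ne j _).symm, rfl⟩
  have h5 : ({p, D i p, D j (D i p)} : Finset TriCell) ⊆ S := by
    intro x hx
    simp only [Finset.mem_insert, Finset.mem_singleton] at hx
    rcases hx with rfl | rfl | rfl <;> assumption
  have := Finset.card_le_card h5
  omega

open Classical in
noncomputable def R24 (S : Finset TriCell) : Finset TriCell :=
  if ∃ p ∈ S, D 1 p ∈ S ∨ D 2 p ∈ S then S.biUnion nbrs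
  else S.biUnion (fun p => {D 1 p, D 2 p})

lemma R24_nonpartner (S : Finset TriCell) (p : TriCell) (hp : p ∈ S) (m : Fin 3) (hm : m ≠ 0) :
    D m p ∈ R24 S := by
  unfold R24
  split_ifs
  · exact Finset.mem_biUnion.mpr ⟨p, hp, D_mem_nbrs m p⟩
  · refine Finset.mem_biUnion.mpr ⟨p, hp, ?_⟩
    fin_cases m <;> simp at hm ⊢

lemma R24_adj (S : Finset TriCell) (p q : TriCell) (hp : p ∈ S) (m : Fin 3) (hm : m ≠ 0)
    (hd : D m p ∈ S) (hq : q ∈ S) : D 0 q ∈ R24 S := by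
  unfold R24
  rw [if_pos]
  · exact Finset.mem_biUnion.mpr ⟨q, hq, D_mem_nbrs 0 q⟩
  · refine ⟨p, hp, ?_⟩
    fin_cases m
    · exact absurd rfl hm
    · exact Or.inl hd
    · exact Or.inr hd

lemma R24_card (S : Finset TriCell) (hS : S.card = 2) : (R24 S \ S).card ≤ 4 := by
  unfold R24
  split_ifs with h
  · have h' : ∃ m m' : Fin 3, (∀ q, nbrs q = {D 0 q, D m q, D m' q}) ∧ ∃ p ∈ S, D m p ∈ S := by
      obtain ⟨p, hp, h | h⟩ := h
      · exact ⟨1, 2, fun q => rfl, p, hp, h⟩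
      · refine ⟨2, 1, fun q => ?_, p, hp, h⟩
        rw [nbrs, Finset.pair_comm]
    obtain ⟨m, m', hn, p, hp, hd⟩ := h'
    have hSe : S = {p, D m p} := by
      symm
      apply Finset.eq_of_subset_of_card_le
      · intro x hx
        simp only [Finset.mem_insert, Finset.mem_singleton] at hx
        rcases hx with rfl | rfl <;> assumption
      · rw [hS, Finset.card_pair (D_ne m p).symm]
    have hsub : S.biUnion nbrs \ S ⊆ {D 0 p, D m' p, D 0 (D m p), D m' (D m p)} := by
      intro x hx
      rw [Finset.mem_sdiff, Finset.mem_biUnion] at hx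
      obtain ⟨⟨q, hq, hx⟩, hxS⟩ := hx
      rw [hn] at hx
      rw [hSe] at hq hxS
      simp only [Finset.mem_insert, Finset.mem_singleton] at hx hq hxS ⊢
      rcases hq with rfl | rfl
      · tauto
      · rw [D_invol] at hx; tauto
    exact (Finset.card_le_card hsub).trans Finset.card_le_four
  · refine (Finset.card_le_card Finset.sdiff_subset).trans ?_
    have := Finset.card_biUnion_le_card_mul S (fun p => ({D 1 p, D 2 p} : Finset TriCell)) 2
      (fun p _ => Finset.card_le_two)
    omega

lemma loser24 : ¬ IsWinner T42 2 4 := by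
  refine loser 2 4 R24 R24_card ?_
  intro p i j k h1 h2 h3 S hS t ht hb
  have key : ∀ c m, m ≠ 0 → c ∈ chev p i j k → D m c ∈ chev p i j k → t (D m c) = t c := by
    intro c m hm hc hd
    rcases lt_trichotomy (t c) (t (D m c)) with h | h | h
    · exact (hb c hc _ hd h (R24_nonpartner _ c (ht c hc) m hm)).elim
    · exact h.symm
    · refine (hb _ hd c hc h ?_).elim
      have := R24_nonpartner _ _ (ht _ hd) m hm
      rwa [D_invol] at this
  have m0 : p ∈ chev p i j k := by simp [chev]
  have m1 : D i p ∈ chev p i j k := by simp [chev]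
  have m2 : D j (D i p) ∈ chev p i j k := by simp [chev]
  have m3 : D k (D j (D i p)) ∈ chev p i j k := by simp [chev]
  have t0 := ht _ m0
  have t1 := ht _ m1
  have t2 := ht _ m2
  have t3 := ht _ m3
  by_cases hi : i = 0
  · have k2 := key _ j (by omega) m1 m2
    have k3 := key _ k (by omega) m2 m3
    rw [k2] at k3 t2
    rw [k3] at t3
    exact three_not _ (hS _) _ j k h2 t1 t2 t3
  · have k1 := key _ i hi m0 m1
    rw [k1] at t1
    by_cases hj : j = 0
    · subst hj
      have k3 := key _ k (by omega) m2 m3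
      rw [k3] at t3
      rcases lt_trichotomy (t p) (t (D 0 (D i p))) with h | h | h
      · exact hb _ m0 _ m2 h (R24_adj _ p (D i p) t0 i hi t1 t1)
      · rw [← h] at t2
        exact three_not _ (hS _) _ i 0 h1 t0 t1 t2
      · rw [← k1] at h
        refine hb _ m2 _ m1 h ?_
        have := R24_adj _ _ (D 0 (D i p)) t2 k (by omega) t3 t2
        rwa [D_invol] at this
    · have k2 := key _ j hj m1 m2
      rw [k2, k1] at t2
      exact three_not _ (hS _) _ i j h1 t0 t1 t2

/-! ### Winners -/

lemma winner10 : IsWinner T42 1 0 := by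
  classical
  have hf : ∀ M B : Finset TriCell, ∃ T : Finset TriCell,
      (T.card = 1 ∧ Disjoint T (M ∪ B)) ∧
      ((T42 \ (M ∪ B)).Nonempty → T ⊆ T42 \ (M ∪ B)) := by
    intro M B
    by_cases h : (T42 \ (M ∪ B)).Nonempty
    · obtain ⟨x, hx⟩ := h
      refine ⟨{x}, ⟨rfl, ?_⟩, fun _ => by simpa using hx⟩
      rw [Finset.disjoint_singleton_left]
      exact (Finset.mem_sdiff.mp hx).2
    · obtain ⟨T, -, hTc, hTd⟩ := exists_ext (M ∪ B) ∅ (by simp) 1 (by simp)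
      exact ⟨T, ⟨hTc, hTd⟩, fun h' => (h h').elim⟩
  choose f hf1 hf2 using hf
  obtain ⟨σ, hσ⟩ := exists_strategy f
  refine ⟨σ, fun β hβ => ⟨fun n => by rw [hσ]; exact hf1 _ _, ?_⟩⟩
  have hB : ∀ n, breakerMarks β n = ∅ := by
    intro n
    induction n with
    | zero => rfl
    | succ n ih =>
      have := (hβ n).1
      rw [Finset.card_eq_zero] at this
      simp [breakerMarks, ih, this]
  have hc : ∀ n, (T42 \ makerMarks σ β n).card ≤ 4 - n := by
    intro n
    induction n with
    | zero => exact (Finset.card_le_card Finset.sdiff_subset).trans (by decide)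
    | succ n ih =>
      have e : T42 \ makerMarks σ β (n+1) =
          (T42 \ makerMarks σ β n) \ makerMove σ β n := by
        ext x; simp only [makerMarks, Finset.mem_sdiff, Finset.mem_union]; tauto
      rw [e]
      by_cases h : (T42 \ makerMarks σ β n).Nonempty
      · have h1 := hf1 (makerMarks σ β n) (breakerMarks β n)
        have h2 := hf2 (makerMarks σ β n) (breakerMarks β n)
        rw [← hσ, hB, Finset.union_empty] at h1 h2
        rw [Finset.card_sdiff_of_subset (h2 h), h1.1]
        omega
      · rw [Finset.not_nonempty_iff_eq_empty] at h
        simp [h]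
  refine ⟨4, T42, ⟨1, one_mem _, (Set.image_id _).symm⟩, ?_⟩
  have := hc 4
  simp only [Nat.sub_self, Nat.le_zero, Finset.card_eq_zero, Finset.sdiff_eq_empty_iff_subset] at this
  exact_mod_cast this

lemma winner_big (n b : ℕ) (h : 4 ≤ n) : IsWinner T42 n b := by
  obtain ⟨T, hT, hc, -⟩ := exists_ext ∅ T42 (by simp) n (le_trans (by decide) h)
  refine winner_of_two n b T hc fun B _ _ => ⟨T42, ⟨1, one_mem _, (Set.image_id _).symm⟩, ?_, ?_⟩
  · rw [Finset.sdiff_eq_empty_iff_subset.mpr hT]; simp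
  · rw [Finset.sdiff_eq_empty_iff_subset.mpr hT]; simp

def perms : List (Fin 3 × Fin 3 × Fin 3) :=
  [(0,1,2), (0,2,1), (1,0,2), (1,2,0), (2,0,1), (2,1,0)]

/-- all chevrons containing `p` (some repeated). -/
def chevs (p : TriCell) : List (Finset TriCell) :=
  perms.flatMap fun s =>
    [chev p s.1 s.2.1 s.2.2, chev (D s.1 p) s.1 s.2.1 s.2.2]

lemma chevs_placement (p : TriCell) (P : Finset TriCell) (h : P ∈ chevs p) :
    IsTriPlacement T42 (P : Set TriCell) := by
  simp only [chevs, List.mem_flatMap] at h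
  obtain ⟨⟨i, j, k⟩, hs, h⟩ := h
  have hd : i ≠ j ∧ j ≠ k ∧ i ≠ k := by
    clear h; revert i j k; decide
  simp only [List.mem_cons, List.not_mem_nil, or_false] at h
  rcases h with rfl | rfl <;> exact chev_placement _ _ _ _ hd.1 hd.2.1 hd.2.2

def reg (p : TriCell) : Finset TriCell := ((chevs p).foldr (· ∪ ·) ∅).erase p

def c0 : TriCell := (0,0,0)
def c1 : TriCell := (10,0,0)
def c2 : TriCell := (20,0,0)

lemma chk0 : ∀ u ∈ reg c0, ∀ v ∈ reg c0, ∃ P ∈ chevs c0, c0 ∈ P ∧ u ∉ P ∧ v ∉ P := by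
  decide +kernel
lemma chk1 : ∀ u ∈ reg c1, ∀ v ∈ reg c1, ∃ P ∈ chevs c1, c1 ∈ P ∧ u ∉ P ∧ v ∉ P := by
  decide +kernel
lemma chk2 : ∀ u ∈ reg c2, ∀ v ∈ reg c2, ∃ P ∈ chevs c2, c2 ∈ P ∧ u ∉ P ∧ v ∉ P := by
  decide +kernel

lemma subset_pair (s A : Finset TriCell) (h : s.card ≤ 2) (hs : s ⊆ A) (hA : A.Nonempty) :
    ∃ u ∈ A, ∃ v ∈ A, s ⊆ {u, v} := by
  obtain ⟨w, hw⟩ := hA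
  have : s.card = 0 ∨ s.card = 1 ∨ s.card = 2 := by omega
  rcases this with h | h | h
  · rw [Finset.card_eq_zero] at h
    exact ⟨w, hw, w, hw, by simp [h]⟩
  · obtain ⟨u, rfl⟩ := Finset.card_eq_one.mp h
    exact ⟨u, hs (by simp), u, hs (by simp), by simp⟩
  · obtain ⟨u, v, -, rfl⟩ := Finset.card_eq_two.mp h
    exact ⟨u, hs (by simp), v, hs (by simp), by simp⟩

lemma mem_foldr (l : List (Finset TriCell)) (P : Finset TriCell) (hP : P ∈ l) :
    P ⊆ l.foldr (· ∪ ·) ∅ := by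
  induction l with
  | nil => simp at hP
  | cons a l ih =>
    rcases List.mem_cons.mp hP with rfl | h
    · exact Finset.subset_union_left
    · exact (ih h).trans Finset.subset_union_right

lemma win_at (p : TriCell) (hne : (reg p).Nonempty)
    (hchk : ∀ u ∈ reg p, ∀ v ∈ reg p, ∃ P ∈ chevs p, p ∈ P ∧ u ∉ P ∧ v ∉ P)
    (S B : Finset TriCell) (hp : p ∈ S) (hd : Disjoint B S) (hB : (B ∩ reg p).card ≤ 2)
    (h4 : ∀ P ∈ chevs p, P.card ≤ 4) :
    ∃ P : Finset TriCell, IsTriPlacement T42 (P : Set TriCell) ∧ Disjoint (P \ S) B ∧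
        (P \ S).card ≤ 3 := by
  obtain ⟨u, hu, v, hv, hs⟩ := subset_pair _ _ hB Finset.inter_subset_right hne
  obtain ⟨P, hP, hpP, huP, hvP⟩ := hchk u hu v hv
  refine ⟨P, chevs_placement p P hP, ?_, ?_⟩
  · rw [Finset.disjoint_left]
    intro x hx hxB
    rw [Finset.mem_sdiff] at hx
    have hxp : x ≠ p := by rintro rfl; exact hx.2 hp
    have hxr : x ∈ reg p := Finset.mem_erase.mpr ⟨hxp, mem_foldr _ P hP hx.1⟩
    have := hs (Finset.mem_inter.mpr ⟨hxB, hxr⟩)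
    simp only [Finset.mem_insert, Finset.mem_singleton] at this
    rcases this with rfl | rfl
    · exact huP hx.1
    · exact hvP hx.1
  · have h5 : P \ S ⊆ P.erase p := by
      intro x hx
      rw [Finset.mem_sdiff] at hx
      exact Finset.mem_erase.mpr ⟨by rintro rfl; exact hx.2 hp, hx.1⟩
    have := Finset.card_le_card h5
    rw [Finset.card_erase_of_mem hpP] at this
    have := h4 P hP
    omega

lemma chevs_card (p : TriCell) : ∀ P ∈ chevs p, P.card ≤ 4 := by
  intro P h
  simp only [chevs, List.mem_flatMap] at h
  obtain ⟨⟨i, j, k⟩, hs, h⟩ := h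
  simp only [List.mem_cons, List.not_mem_nil, or_false] at h
  rcases h with rfl | rfl <;> exact Finset.card_le_four

lemma winner38 : IsWinner T42 3 8 := by
  refine winner_of_two 3 8 {c0, c1, c2} (by decide +kernel) fun B hB hd => ?_
  have d01 : Disjoint (reg c0) (reg c1) := by decide +kernel
  have d02 : Disjoint (reg c0) (reg c2) := by decide +kernel
  have d12 : Disjoint (reg c1) (reg c2) := by decide +kernel
  by_cases h0 : (B ∩ reg c0).card ≤ 2
  · exact win_at c0 (by decide +kernel) chk0 _ B (by simp) hd h0 (chevs_card _)
  by_cases h1 : (B ∩ reg c1).card ≤ 2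
  · exact win_at c1 (by decide +kernel) chk1 _ B (by simp) hd h1 (chevs_card _)
  by_cases h2 : (B ∩ reg c2).card ≤ 2
  · exact win_at c2 (by decide +kernel) chk2 _ B (by simp) hd h2 (chevs_card _)
  exfalso
  have e01 : Disjoint (B ∩ reg c0) (B ∩ reg c1) :=
    d01.mono Finset.inter_subset_right Finset.inter_subset_right
  have e2 : Disjoint ((B ∩ reg c0) ∪ (B ∩ reg c1)) (B ∩ reg c2) :=
    Finset.disjoint_union_left.mpr
      ⟨d02.mono Finset.inter_subset_right Finset.inter_subset_right,
       d12.mono Finset.inter_subset_right Finset.inter_subset_right⟩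
  have hsub : ((B ∩ reg c0) ∪ (B ∩ reg c1)) ∪ (B ∩ reg c2) ⊆ B := by
    exact Finset.union_subset (Finset.union_subset Finset.inter_subset_left
      Finset.inter_subset_left) Finset.inter_subset_left
  have := Finset.card_le_card hsub
  rw [Finset.card_union_of_disjoint e2, Finset.card_union_of_disjoint e01] at this
  omega

def S2 : Finset TriCell := {(0,0,0), (0,0,1)}

def chevs2 : List (Finset TriCell) := (chevs c0 ++ chevs (0,0,1)).filter fun P => S2 ⊆ P

def reg2 : Finset TriCell := (chevs2.foldr (· ∪ ·) ∅) \ S2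

lemma chk23 : ∀ Q ∈ reg2.powerset, Q.card ≤ 3 → ∃ P ∈ chevs2, Disjoint P Q := by
  decide +kernel

lemma winner23 : IsWinner T42 2 3 := by
  refine winner_of_two 2 3 S2 (by decide) fun B hB hd => ?_
  obtain ⟨P, hP, hPd⟩ := chk23 (B ∩ reg2) (Finset.mem_powerset.mpr Finset.inter_subset_right)
    ((Finset.card_le_card Finset.inter_subset_left).trans hB.le)
  have hP' := hP
  simp only [chevs2, List.mem_filter, List.mem_append, decide_eq_true_eq] at hP'
  refine ⟨P, ?_, ?_, ?_⟩
  · rcases hP'.1 with h | h <;> exact chevs_placement _ _ h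
  · rw [Finset.disjoint_left]
    intro x hx hxB
    rw [Finset.mem_sdiff] at hx
    exact Finset.disjoint_left.mp hPd hx.1 (Finset.mem_inter.mpr ⟨hxB,
      Finset.mem_sdiff.mpr ⟨mem_foldr _ P hP hx.1, hx.2⟩⟩)
  · rw [Finset.card_sdiff_of_subset hP'.2]
    have h4 : P.card ≤ 4 := by rcases hP'.1 with h | h <;> exact chevs_card _ _ h
    have : S2.card = 2 := by decide
    omega

end T42aux

/-- `T₄,₂` has threshold sequence `(0, 3, 8, ∞)`: it is a `(1,0)`-winner, a `(1,1)`-loser,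
a `(2,3)`-winner, a `(2,4)`-loser, a `(3,8)`-winner, a `(3,9)`-loser, and an
`(n,b)`-winner for every `n ≥ 4` and every `b`. -/
theorem T42_threshold :
    IsWinner T42 1 0 ∧ ¬ IsWinner T42 1 1 ∧
    IsWinner T42 2 3 ∧ ¬ IsWinner T42 2 4 ∧
    IsWinner T42 3 8 ∧ ¬ IsWinner T42 3 9 ∧
    ∀ n b : ℕ, 4 ≤ n → IsWinner T42 n b :=
  ⟨T42aux.winner10, T42aux.loser11, T42aux.winner23, T42aux.loser24, T42aux.winner38,
    T42aux.loser39, T42aux.winner_big⟩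
end

section
/- The polyiamond T₄,₃ = {(0,0,0),(0,0,1),(1,0,0),(0,1,0)} (the triangle of size four) has threshold sequence (0,3,8,∞): it is a (1,0)-winner, a (1,1)-loser, a (2,3)-winner, a (2,4)-loser, a (3,8)-winner, a (3,9)-loser, and an (n,b)-winner for every n ≥ 4 and every b ∈ ℕ. -/
/-- The polyiamond `T₄,₃`, the triangle of size four. -/
def T43 : Finset TriCell := {(0, 0, 0), (0, 0, 1), (1, 0, 0), (0, 1, 0)}

/-! ### Generic facts -/

lemma exists_ext (A F : Finset TriCell) (n : ℕ) (hA : A.card ≤ n) (hd : Disjoint A F) :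
    ∃ Y : Finset TriCell, A ⊆ Y ∧ Y.card = n ∧ Disjoint Y F := by
  classical
  obtain ⟨Z, hZ1, hZ2⟩ := Infinite.exists_superset_card_eq (A ∪ F) (n + (A ∪ F).card) (by omega)
  have hc : n ≤ (Z \ F).card := by
    have h1 := Finset.le_card_sdiff F Z
    have h2 : F.card ≤ (A ∪ F).card := Finset.card_le_card Finset.subset_union_right
    omega
  have hs : A ⊆ Z \ F := by
    intro p hp
    rw [Finset.mem_sdiff]
    exact ⟨hZ1 (Finset.mem_union_left _ hp), Finset.disjoint_left.mp hd hp⟩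
  obtain ⟨Y, h1, h2, h3⟩ := Finset.exists_subsuperset_card_eq hs hA hc
  exact ⟨Y, h1, h3, Finset.disjoint_of_subset_left h2 Finset.sdiff_disjoint⟩

/-- The maker, to move, can win in exactly `k` further turns. -/
def WinIn (a b : ℕ) : ℕ → Finset TriCell → Finset TriCell → Prop
  | 0, M, _ => ∃ P : Set TriCell, IsTriPlacement T43 P ∧ P ⊆ ↑M
  | k + 1, M, B => ∃ X : Finset TriCell, X.card = a ∧ Disjoint X (M ∪ B) ∧
      ∀ Y : Finset TriCell, Y.card = b → Disjoint Y (M ∪ X ∪ B) → WinIn a b k (M ∪ X) (B ∪ Y)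

lemma mv_exists (a b k : ℕ) (M B : Finset TriCell) :
    ∃ X : Finset TriCell, (X.card = a ∧ Disjoint X (M ∪ B)) ∧ (WinIn a b k M B → 1 ≤ k →
      ∀ Y : Finset TriCell, Y.card = b → Disjoint Y (M ∪ X ∪ B) →
        WinIn a b (k - 1) (M ∪ X) (B ∪ Y)) := by
  by_cases h : WinIn a b k M B ∧ 1 ≤ k
  · obtain ⟨h, hk⟩ := h
    obtain ⟨j, rfl⟩ : ∃ j, k = j + 1 := ⟨k - 1, by omega⟩
    obtain ⟨X, h1, h2, h3⟩ := h
    exact ⟨X, ⟨h1, h2⟩, fun _ _ => h3⟩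
  · obtain ⟨X, -, h1, h2⟩ := exists_ext ∅ (M ∪ B) a (by simp) (by simp)
    exact ⟨X, ⟨h1, h2⟩, fun h' h'' => absurd ⟨h', h''⟩ h⟩

theorem isWinner_of_winIn (a b N : ℕ) (h : WinIn a b N ∅ ∅) : IsWinner T43 a b := by
  classical
  choose mv hmv1 hmv2 using mv_exists a b
  let step : (ℕ × Finset TriCell × Finset TriCell) → Finset TriCell →
      (ℕ × Finset TriCell × Finset TriCell) :=
    fun s Y => (s.1 - 1, s.2.1 ∪ mv s.1 s.2.1 s.2.2, s.2.2 ∪ Y)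
  let st : List (Finset TriCell) → (ℕ × Finset TriCell × Finset TriCell) :=
    fun L => L.foldl step (N, ∅, ∅)
  let σ : List (Finset TriCell) → Finset TriCell :=
    fun L => mv (st L).1 (st L).2.1 (st L).2.2
  refine ⟨σ, fun β hβ => ?_⟩
  have hst : ∀ n, st ((List.range n).map β) = (N - n, makerMarks σ β n, breakerMarks β n) := by
    intro n
    induction n with
    | zero => simp [st, makerMarks, breakerMarks]
    | succ n ih =>
      have : st ((List.range (n + 1)).map β) = step (st ((List.range n).map β)) (β n) := by
        simp [st, List.range_succ]
      rw [this, makerMarks, breakerMarks, makerMove]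
      simp only [step, σ, ih]
      rw [Nat.sub_sub]
  have hmove : ∀ n, makerMove σ β n = mv (N - n) (makerMarks σ β n) (breakerMarks β n) := by
    intro n
    simp only [makerMove, σ, hst]
  constructor
  · intro n
    rw [hmove]
    exact hmv1 _ _ _
  · have key : ∀ n, n ≤ N → WinIn a b (N - n) (makerMarks σ β n) (breakerMarks β n) := by
      intro n
      induction n with
      | zero => intro _; simpa [makerMarks, breakerMarks] using h
      | succ n ih =>
        intro hn
        have h1 := hmv2 _ _ _ (ih (by omega)) (by omega) (β n) (hβ n).1 (by
          have := (hβ n).2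
          rw [makerMarks, hmove] at this
          exact this)
        rw [makerMarks, breakerMarks, hmove, ← Nat.sub_sub]
        exact h1
    have := key N le_rfl
    rw [Nat.sub_self] at this
    exact ⟨N, this⟩

/-! ### Losing results -/

/-- The neighbour of a cell along an edge of colour `i`. -/
def nb (i : Fin 3) (p : TriCell) : TriCell :=
  if p.2.2 = 0 then
    (if i = 0 then (p.1, p.2.1, 1) else if i = 1 then (p.1 - 1, p.2.1, 1) else (p.1, p.2.1 - 1, 1))
  else
    (if i = 0 then (p.1, p.2.1, 0) else if i = 1 then (p.1 + 1, p.2.1, 0) else (p.1, p.2.1 + 1, 0))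

lemma nb_nb (i : Fin 3) (p : TriCell) : nb i (nb i p) = p := by
  obtain ⟨x, y, u⟩ := p
  fin_cases i <;> fin_cases u <;> simp [nb]

lemma nb_inj (p : TriCell) : Function.Injective (fun i => nb i p) := by
  obtain ⟨x, y, u⟩ := p
  intro i j
  fin_cases i <;> fin_cases j <;> fin_cases u <;> simp [nb] <;> omega

lemma nb_ne (i : Fin 3) (p : TriCell) : nb i p ≠ p := by
  obtain ⟨x, y, u⟩ := p
  fin_cases i <;> fin_cases u <;> simp [nb]

lemma symm_star (f : Function.End TriCell) (hf : f ∈ triSymmetries) :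
    ∀ c i, ∃ j, nb i (f c) = f (nb j c) := by
  induction hf using Submonoid.closure_induction with
  | mem f hf =>
    rintro ⟨x, y, u⟩ i
    rcases hf with ⟨a, b, rfl⟩ | rfl | rfl
    · refine ⟨i, ?_⟩
      fin_cases i <;> fin_cases u <;> simp [nb] <;> ring
    · fin_cases i <;> fin_cases u
      · exact ⟨1, by simp [nb, triRot]; try omega⟩
      · exact ⟨1, by simp [nb, triRot]; try omega⟩
      · exact ⟨2, by simp [nb, triRot]; try omega⟩
      · exact ⟨2, by simp [nb, triRot]; try omega⟩
      · exact ⟨0, by simp [nb, triRot]⟩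
      · exact ⟨0, by simp [nb, triRot]⟩
    · fin_cases i <;> fin_cases u
      · exact ⟨0, by simp [nb, triRefl]⟩
      · exact ⟨0, by simp [nb, triRefl]⟩
      · exact ⟨2, by simp [nb, triRefl]⟩
      · exact ⟨2, by simp [nb, triRefl]⟩
      · exact ⟨1, by simp [nb, triRefl]⟩
      · exact ⟨1, by simp [nb, triRefl]⟩
  | one => exact fun c i => ⟨i, rfl⟩
  | mul f g _ _ hf hg =>
    intro c i
    obtain ⟨j, hj⟩ := hf (g c) i
    obtain ⟨k, hk⟩ := hg c j
    exact ⟨k, by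
      change nb i (f (g c)) = f (g (nb k c))
      rw [hj, hk]⟩

lemma placement_star (P : Set TriCell) (hP : IsTriPlacement T43 P) :
    ∃ c, c ∈ P ∧ ∀ i, nb i c ∈ P := by
  obtain ⟨f, hf, rfl⟩ := hP
  refine ⟨f (0, 0, 1), ⟨_, by simp [T43], rfl⟩, fun i => ?_⟩
  obtain ⟨j, hj⟩ := symm_star f hf (0, 0, 1) i
  rw [hj]
  refine ⟨_, ?_, rfl⟩
  fin_cases j <;> simp [nb, T43]

lemma reply_exists (a : ℕ) (X M B : Finset TriCell) :
    ∃ Y : Finset TriCell, Y.card = a * a ∧ Disjoint Y (M ∪ B) ∧ (X.card = a →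
      ∀ p ∈ X, ∀ i : Fin 3, i.val < a → nb i p ∈ M ∪ (B ∪ Y)) := by
  classical
  by_cases hX : X.card = a
  · let I : Finset (Fin 3) := Finset.univ.filter (fun i => i.val < a)
    have hI : I.card ≤ a := by
      have : (I.image Fin.val).card = I.card :=
        Finset.card_image_of_injective _ Fin.val_injective
      rw [← this]
      calc (I.image Fin.val).card ≤ (Finset.range a).card := by
            apply Finset.card_le_card
            intro k hk
            simp only [I, Finset.mem_image, Finset.mem_filter] at hk
            obtain ⟨i, hi, rfl⟩ := hk
            simpa using hi.2
        _ = a := Finset.card_range a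
    let A := (X ×ˢ I).image (fun q => nb q.2 q.1)
    have hA : A.card ≤ a * a := by
      calc A.card ≤ (X ×ˢ I).card := Finset.card_image_le
        _ = X.card * I.card := Finset.card_product _ _
        _ ≤ a * a := by rw [hX]; exact Nat.mul_le_mul_left _ hI
    obtain ⟨Y, h1, h2, h3⟩ := exists_ext (A \ (M ∪ B)) (M ∪ B) (a * a)
      ((Finset.card_le_card Finset.sdiff_subset).trans hA) Finset.sdiff_disjoint
    refine ⟨Y, h2, h3, fun _ p hp i hi => ?_⟩
    by_cases hm : nb i p ∈ M ∪ B
    · simp only [Finset.mem_union] at hm ⊢; tauto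
    · have : nb i p ∈ A \ (M ∪ B) := by
        rw [Finset.mem_sdiff]
        refine ⟨Finset.mem_image.mpr ⟨(p, i), ?_, rfl⟩, hm⟩
        simp [I, hp, hi]
      have := h1 this
      simp only [Finset.mem_union]; tauto
  · obtain ⟨Y, -, h1, h2⟩ := exists_ext ∅ (M ∪ B) (a * a) (by simp) (by simp)
    exact ⟨Y, h1, h2, fun h => absurd h hX⟩

theorem loser (a : ℕ) (ha : a ≤ 3) : ¬ IsWinner T43 a (a * a) := by
  classical
  rintro ⟨σ, hσ⟩
  choose rp hrp1 hrp2 hrp3 using reply_exists a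
  let st : ℕ → List (Finset TriCell) × Finset TriCell × Finset TriCell := fun n =>
    Nat.rec ([], ∅, ∅) (fun _ s => (s.1 ++ [rp (σ s.1) (s.2.1 ∪ σ s.1) s.2.2],
      s.2.1 ∪ σ s.1, s.2.2 ∪ rp (σ s.1) (s.2.1 ∪ σ s.1) s.2.2)) n
  let β : ℕ → Finset TriCell := fun n =>
    rp (σ (st n).1) ((st n).2.1 ∪ σ (st n).1) (st n).2.2
  have hst : ∀ n, st n = ((List.range n).map β, makerMarks σ β n, breakerMarks β n) := by
    intro n
    induction n with
    | zero => rfl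
    | succ n ih =>
      have h1 : st (n + 1) = ((st n).1 ++ [β n], (st n).2.1 ∪ σ (st n).1, (st n).2.2 ∪ β n) := rfl
      rw [h1, ih, makerMarks, breakerMarks, makerMove]
      simp [List.range_succ]
  have hβ : ∀ n, β n = rp (makerMove σ β n) (makerMarks σ β (n + 1)) (breakerMarks β n) := by
    intro n
    change rp (σ (st n).1) ((st n).2.1 ∪ σ (st n).1) (st n).2.2 = _
    rw [hst]
    rfl
  have hleg : BreakerLegal (a * a) σ β := by
    intro n
    rw [hβ n]
    exact ⟨hrp1 _ _ _, hrp2 _ _ _⟩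
  obtain ⟨hM, n, P, hP, hPM⟩ := hσ β hleg
  have hdis : ∀ n, Disjoint (makerMarks σ β n) (breakerMarks β n) := by
    intro n
    induction n with
    | zero => simp [makerMarks]
    | succ n ih =>
      have h1 := (hM n).2
      have h2 := (hleg n).2
      rw [makerMarks] at h2 ⊢
      rw [breakerMarks]
      rw [Finset.disjoint_left] at *
      intro p hp hp'
      have h1' := @h1 p
      have h2' := @h2 p
      have h3' := @ih p
      simp only [Finset.mem_union] at *
      tauto
  have hmono : ∀ m k, m ≤ k → makerMarks σ β m ⊆ makerMarks σ β k := by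
    intro m k hmk
    induction k, hmk using Nat.le_induction with
    | base => exact Finset.Subset.refl _
    | succ k _ ih => exact ih.trans (by rw [makerMarks]; exact Finset.subset_union_left)
  have hmonoB : ∀ m k, m ≤ k → breakerMarks β m ⊆ breakerMarks β k := by
    intro m k hmk
    induction k, hmk using Nat.le_induction with
    | base => exact Finset.Subset.refl _
    | succ k _ ih => exact ih.trans (by rw [breakerMarks]; exact Finset.subset_union_left)
  have htime : ∀ n p, p ∈ makerMarks σ β n → ∃ t < n, p ∈ makerMove σ β t := by
    intro n p
    induction n with
    | zero => simp [makerMarks]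
    | succ n ih =>
      rw [makerMarks, Finset.mem_union]
      rintro (h | h)
      · obtain ⟨t, ht, h⟩ := ih h
        exact ⟨t, by omega, h⟩
      · exact ⟨n, by omega, h⟩
  have hlt : ∀ p s t, p ∈ makerMove σ β s → p ∈ makerMarks σ β t → s < t := by
    intro p s t hs ht
    by_contra hcon
    have h1 := hmono t s (by omega) ht
    exact Finset.disjoint_left.mp (hM s).2 hs (Finset.mem_union_left _ h1)
  have hin : ∀ s p, p ∈ makerMove σ β s → p ∈ makerMarks σ β (s + 1) := by
    intro s p h
    rw [makerMarks]; exact Finset.mem_union_right _ h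
  have key : ∀ p (i : Fin 3) s t, i.val < a → p ∈ makerMove σ β s →
      nb i p ∈ makerMove σ β t → t ≤ s := by
    intro p i s t hi hp hq
    have h1 := hrp3 (makerMove σ β s) (makerMarks σ β (s + 1)) (breakerMarks β s)
      (hM s).1 p hp i hi
    rw [← hβ s] at h1
    rcases Finset.mem_union.mp h1 with h1 | h1
    · have := hlt _ _ _ hq h1
      omega
    · exfalso
      change _ ∈ breakerMarks β (s + 1) at h1
      have h2 := hmono (t + 1) (s + 1 + (t + 1)) (by omega) (hin _ _ hq)
      have h3 := hmonoB (s + 1) (s + 1 + (t + 1)) (by omega) h1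
      exact Finset.disjoint_left.mp (hdis _) h2 h3
  obtain ⟨c, hc, hcn⟩ := placement_star P hP
  obtain ⟨s, -, hs⟩ := htime n c (hPM hc)
  have hall : ∀ i : Fin 3, i.val < a → nb i c ∈ makerMove σ β s := by
    intro i hi
    obtain ⟨t, -, ht⟩ := htime n _ (hPM (hcn i))
    have h1 := key c i s t hi hs ht
    have h2 := key (nb i c) i t s hi ht (by rw [nb_nb]; exact hs)
    have : t = s := by omega
    rwa [this] at ht
  have hsub : insert c ((Finset.univ : Finset (Fin a)).image
      (fun i => nb (Fin.castLE ha i) c)) ⊆ makerMove σ β s := by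
    intro p hp
    rw [Finset.mem_insert, Finset.mem_image] at hp
    rcases hp with rfl | ⟨i, -, rfl⟩
    · exact hs
    · exact hall _ i.isLt
  have hcard := Finset.card_le_card hsub
  rw [(hM s).1, Finset.card_insert_of_notMem, Finset.card_image_of_injective] at hcard
  · simp at hcard
  · intro i j hij
    exact Fin.castLE_injective ha (nb_inj c hij)
  · intro h
    rw [Finset.mem_image] at h
    obtain ⟨i, -, h⟩ := h
    exact nb_ne _ _ h

/-! ### Winning results -/

/-- The placement of `T₄,₃` centred at a downward cell. -/
def dstar (c : ℤ × ℤ) : Finset TriCell :=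
  {(c.1, c.2, 0), (c.1, c.2, 1), (c.1 + 1, c.2, 0), (c.1, c.2 + 1, 0)}

lemma dstar_placement (c : ℤ × ℤ) : IsTriPlacement T43 (↑(dstar c) : Set TriCell) := by
  refine ⟨fun p => (p.1 + c.1, p.2.1 + c.2, p.2.2),
    Submonoid.subset_closure (Or.inl ⟨c.1, c.2, rfl⟩), ?_⟩
  simp [T43, dstar, Set.image_insert_eq, add_comm]

lemma win_one (a b : ℕ) (M B : Finset TriCell) (c : ℤ × ℤ) (h1 : (dstar c \ M).card ≤ a)
    (h2 : Disjoint (dstar c \ M) B) : WinIn a b 1 M B := by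
  obtain ⟨X, hX1, hX2, hX3⟩ := exists_ext (dstar c \ M) (M ∪ B) a h1
    (Finset.disjoint_union_right.mpr ⟨Finset.sdiff_disjoint, h2⟩)
  refine ⟨X, hX2, hX3, fun Y _ _ => ⟨_, dstar_placement c, ?_⟩⟩
  intro p hp
  rw [Finset.mem_coe] at hp ⊢
  rw [Finset.mem_union]
  by_cases hm : p ∈ M
  · exact Or.inl hm
  · exact Or.inr (hX1 (Finset.mem_sdiff.mpr ⟨hp, hm⟩))

lemma pigeon {ι : Type*} (I : Finset ι) (Z : ι → Finset TriCell) (Y : Finset TriCell)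
    (hZ : ∀ i ∈ I, ∀ j ∈ I, i ≠ j → Disjoint (Z i) (Z j)) (hc : Y.card < I.card) :
    ∃ i ∈ I, Disjoint (Z i) Y := by
  classical
  by_contra! hcon
  have : ∀ i, ∃ y, i ∈ I → y ∈ Z i ∧ y ∈ Y := by
    intro i
    by_cases hi : i ∈ I
    · obtain ⟨y, h1, h2⟩ := Finset.not_disjoint_iff.mp (hcon i hi)
      exact ⟨y, fun _ => ⟨h1, h2⟩⟩
    · exact ⟨(0, 0, 0), fun h => absurd h hi⟩
  choose f hf using this
  have := Finset.card_le_card_of_injOn (s := I) (t := Y) f (fun i hi => (hf i hi).2) (by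
    intro i hi j hj hij
    by_contra hne
    exact Finset.disjoint_left.mp (hZ i hi j hj hne) (hf i hi).1 (hij ▸ (hf j hj).1))
  omega

theorem win_four (n b : ℕ) (hn : 4 ≤ n) : IsWinner T43 n b := by
  apply isWinner_of_winIn n b 1
  apply win_one n b ∅ ∅ (0, 0)
  · exact le_trans (by decide) hn
  · simp

theorem win_1_0 : IsWinner T43 1 0 := by
  apply isWinner_of_winIn 1 0 4
  refine ⟨{(0, 0, 0)}, rfl, by decide, fun Y hY _ => ?_⟩
  obtain rfl := Finset.card_eq_zero.mp hY
  refine ⟨{(0, 0, 1)}, rfl, by decide, fun Y hY _ => ?_⟩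
  obtain rfl := Finset.card_eq_zero.mp hY
  refine ⟨{(1, 0, 0)}, rfl, by decide, fun Y hY _ => ?_⟩
  obtain rfl := Finset.card_eq_zero.mp hY
  exact win_one 1 0 _ _ (0, 0) (by decide) (by decide)

theorem win_3_8 : IsWinner T43 3 8 := by
  apply isWinner_of_winIn 3 8 2
  refine ⟨{(0, 0, 0), (10, 0, 0), (20, 0, 0)}, rfl, by decide, fun Y hY _ => ?_⟩
  obtain ⟨c, hc, hd⟩ := pigeon
    ({(0, 0), (-1, 0), (0, -1), (10, 0), (9, 0), (10, -1), (20, 0), (19, 0), (20, -1)} :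
      Finset (ℤ × ℤ))
    (fun c => dstar c \ (∅ ∪ {(0, 0, 0), (10, 0, 0), (20, 0, 0)})) Y
    (by decide +kernel) (by rw [hY]; decide)
  refine win_one 3 8 _ _ c ?_ (by simpa using hd)
  revert c
  have : ∀ c ∈ ({(0, 0), (-1, 0), (0, -1), (10, 0), (9, 0), (10, -1), (20, 0), (19, 0), (20, -1)} :
      Finset (ℤ × ℤ)), (dstar c \ (∅ ∪ {(0, 0, 0), (10, 0, 0), (20, 0, 0)})).card ≤ 3 := by
    decide +kernel
  exact fun c hc _ => this c hc

/-! ### The (2,3) game: many far apart boards, each a local (1,1) game -/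

/-- The region of a local board. -/
def Reg : Finset TriCell :=
  ({-2, -1, 0, 1, 2} : Finset ℤ) ×ˢ ({-2, -1, 0, 1, 2} : Finset ℤ) ×ˢ ({0, 1} : Finset (Fin 2))

/-- In the local game (maker to move) the maker can, in `k` single-cell moves each answered by
a single cell, reach a live placement with at most two cells missing. -/
def Loc : ℕ → Finset TriCell → Finset TriCell → Prop
  | 0, m, b => ∃ c, dstar c ⊆ Reg ∧ (dstar c \ m).card ≤ 2 ∧ Disjoint (dstar c \ m) b
  | k + 1, m, b => ∃ x ∈ Reg, x ∉ m ∧ x ∉ b ∧ ∀ y, Loc k (insert x m) (insert y b)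

lemma Loc.anti {k : ℕ} {m b b' : Finset TriCell} (h : Loc k m b) (hb : b' ⊆ b) :
    Loc k m b' := by
  induction k generalizing m b b' with
  | zero =>
    obtain ⟨c, h1, h2, h3⟩ := h
    exact ⟨c, h1, h2, Finset.disjoint_of_subset_right hb h3⟩
  | succ k ih =>
    obtain ⟨x, h1, h2, h3, h4⟩ := h
    exact ⟨x, h1, h2, fun h => h3 (hb h), fun y => ih (h4 y) (Finset.insert_subset_insert y hb)⟩

lemma fork (m b : Finset TriCell) (x : TriCell) (c d : ℤ × ℤ) (hx : x ∈ Reg) (hm : x ∉ m)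
    (hc : dstar c ⊆ Reg) (hd : dstar d ⊆ Reg)
    (hc2 : (dstar c \ insert x m).card ≤ 2) (hd2 : (dstar d \ insert x m).card ≤ 2)
    (hcd : Disjoint (dstar c \ insert x m) (dstar d \ insert x m))
    (hb : Disjoint (insert x ((dstar c ∪ dstar d) \ m)) b) : Loc 1 m b := by
  have hsub : ∀ e, (e = c ∨ e = d) → Disjoint (dstar e \ insert x m) b := by
    intro e he
    refine Finset.disjoint_of_subset_left ?_ hb
    intro p hp
    simp only [Finset.mem_sdiff, Finset.mem_insert, Finset.mem_union] at hp ⊢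
    rcases he with rfl | rfl <;> tauto
  refine ⟨x, hx, hm, fun h => Finset.disjoint_left.mp hb (Finset.mem_insert_self _ _) h,
    fun y => ?_⟩
  by_cases hy : y ∈ dstar c \ insert x m
  · refine ⟨d, hd, hd2, ?_⟩
    rw [Finset.disjoint_insert_right]
    exact ⟨Finset.disjoint_left.mp hcd hy, hsub d (Or.inr rfl)⟩
  · refine ⟨c, hc, hc2, ?_⟩
    rw [Finset.disjoint_insert_right]
    exact ⟨hy, hsub c (Or.inl rfl)⟩

/-- Two disjoint forks. -/
lemma two_forks (m b : Finset TriCell) (v x x' : TriCell) (c d c' d' : ℤ × ℤ)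
    (hv : v ∈ Reg ∧ v ∉ m)
    (hx : x ∈ Reg ∧ x ∉ insert v m ∧ dstar c ⊆ Reg ∧ dstar d ⊆ Reg ∧
      (dstar c \ insert x (insert v m)).card ≤ 2 ∧ (dstar d \ insert x (insert v m)).card ≤ 2 ∧
      Disjoint (dstar c \ insert x (insert v m)) (dstar d \ insert x (insert v m)))
    (hx' : x' ∈ Reg ∧ x' ∉ insert v m ∧ dstar c' ⊆ Reg ∧ dstar d' ⊆ Reg ∧
      (dstar c' \ insert x' (insert v m)).card ≤ 2 ∧
      (dstar d' \ insert x' (insert v m)).card ≤ 2 ∧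
      Disjoint (dstar c' \ insert x' (insert v m)) (dstar d' \ insert x' (insert v m)))
    (hdis : Disjoint (insert x ((dstar c ∪ dstar d) \ insert v m))
      (insert x' ((dstar c' ∪ dstar d') \ insert v m)))
    (hb : Disjoint (insert v (insert x ((dstar c ∪ dstar d) \ insert v m) ∪
      (insert x' ((dstar c' ∪ dstar d') \ insert v m)))) b) : Loc 2 m b := by
  rw [Finset.disjoint_insert_left, Finset.disjoint_union_left] at hb
  obtain ⟨hb0, hb1, hb2⟩ := hb
  refine ⟨v, hv.1, hv.2, hb0, fun y => ?_⟩
  by_cases hy : y ∈ insert x ((dstar c ∪ dstar d) \ insert v m)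
  · obtain ⟨h1, h2, h3, h4, h5, h6, h7⟩ := hx'
    refine fork _ _ x' c' d' h1 h2 h3 h4 h5 h6 h7 ?_
    rw [Finset.disjoint_insert_right]
    exact ⟨Finset.disjoint_left.mp hdis hy, hb2⟩
  · obtain ⟨h1, h2, h3, h4, h5, h6, h7⟩ := hx
    refine fork _ _ x c d h1 h2 h3 h4 h5 h6 h7 ?_
    rw [Finset.disjoint_insert_right]
    exact ⟨hy, hb1⟩

/-- The cells used by the forks after the second move `v`. -/
def Zset (v x x' : TriCell) (c d c' d' : ℤ × ℤ) : Finset TriCell :=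
  insert v (insert x ((dstar c ∪ dstar d) \ insert v {(0, 0, 0)}) ∪
      (insert x' ((dstar c' ∪ dstar d') \ insert v {(0, 0, 0)})))

lemma loc_three : Loc 3 ∅ ∅ := by
  refine ⟨(0, 0, 0), by decide, by simp, by simp, fun y => ?_⟩
  have hs : (insert (0, 0, 0) ∅ : Finset TriCell) = {(0, 0, 0)} := rfl
  have hs' : (insert y ∅ : Finset TriCell) = {y} := rfl
  rw [hs, hs']
  by_cases h1 : y ∈ Zset (-1, 0, 0) (0, -1, 0) (-2, 0, 0) (0, -1) (-1, -1) (-1, 0) (-2, 0)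
  · by_cases h2 : y ∈ Zset (1, -1, 0) (2, -2, 0) (1, 0, 0) (0, -1) (1, -2) (1, -1) (0, 0)
    · have h3 : ∀ y ∈ Zset (-1, 0, 0) (0, -1, 0) (-2, 0, 0) (0, -1) (-1, -1) (-1, 0) (-2, 0),
          y ∈ Zset (1, -1, 0) (2, -2, 0) (1, 0, 0) (0, -1) (1, -2) (1, -1) (0, 0) →
          y ∉ Zset (-1, 1, 0) (0, 1, 0) (-2, 2, 0) (0, 0) (-1, 1) (-1, 0) (-2, 1) := by
        decide +kernel
      exact two_forks _ _ (-1, 1, 0) (0, 1, 0) (-2, 2, 0) (0, 0) (-1, 1) (-1, 0) (-2, 1)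
        (by decide +kernel) (by decide +kernel) (by decide +kernel) (by decide +kernel)
        (Finset.disjoint_singleton_right.mpr (h3 y h1 h2))
    · exact two_forks _ _ (1, -1, 0) (2, -2, 0) (1, 0, 0) (0, -1) (1, -2) (1, -1) (0, 0)
        (by decide +kernel) (by decide +kernel) (by decide +kernel) (by decide +kernel)
        (Finset.disjoint_singleton_right.mpr h2)
  · exact two_forks _ _ (-1, 0, 0) (0, -1, 0) (-2, 0, 0) (0, -1) (-1, -1) (-1, 0) (-2, 0)
      (by decide +kernel) (by decide +kernel) (by decide +kernel) (by decide +kernel)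
      (Finset.disjoint_singleton_right.mpr h1)

/-- Translation from the local board to the `i`-th board. -/
def sh (i : ℕ) (p : TriCell) : TriCell := (p.1 + 20 * (i : ℤ), p.2.1, p.2.2)

lemma sh_inj {i j : ℕ} {p q : TriCell} (hp : p ∈ Reg) (hq : q ∈ Reg) (h : sh i p = sh j q) :
    i = j ∧ p = q := by
  obtain ⟨x, y, u⟩ := p
  obtain ⟨x', y', u'⟩ := q
  simp only [Reg, Finset.mem_product, Finset.mem_insert, Finset.mem_singleton] at hp hq
  simp only [sh, Prod.mk.injEq] at h
  have h1 := hp.1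
  have h2 := hq.1
  have h3 := h.1
  have hij : i = j := by omega
  refine ⟨hij, ?_⟩
  subst hij
  simp only [Prod.mk.injEq]
  exact ⟨by omega, h.2⟩

/-- The view of a set of cells on the `i`-th board. -/
def view (i : ℕ) (M : Finset TriCell) : Finset TriCell := Reg.filter (fun p => sh i p ∈ M)

lemma mem_view {i : ℕ} {M : Finset TriCell} {p : TriCell} :
    p ∈ view i M ↔ p ∈ Reg ∧ sh i p ∈ M := by simp [view]

lemma view_union (i : ℕ) (M X : Finset TriCell) : view i (M ∪ X) = view i M ∪ view i X := by
  ext p; simp only [mem_view, Finset.mem_union]; tauto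

lemma view_pair {i j : ℕ} (hij : i ≠ j) {x x' : TriCell} (hx : x ∈ Reg) (hx' : x' ∈ Reg) :
    view i {sh i x, sh j x'} = {x} := by
  ext p
  simp only [mem_view, Finset.mem_insert, Finset.mem_singleton]
  constructor
  · rintro ⟨hp, h | h⟩
    · exact (sh_inj hp hx h).2
    · exact absurd (sh_inj hp hx' h).1 hij
  · rintro rfl
    exact ⟨hx, Or.inl rfl⟩

lemma view_pair_other {i j l : ℕ} (hi : l ≠ i) (hj : l ≠ j) {x x' : TriCell} (hx : x ∈ Reg)
    (hx' : x' ∈ Reg) : view l {sh i x, sh j x'} = ∅ := by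
  ext p
  simp only [mem_view, Finset.mem_insert, Finset.mem_singleton, Finset.notMem_empty, iff_false]
  rintro ⟨hp, h | h⟩
  · exact hi (sh_inj hp hx h).1
  · exact hj (sh_inj hp hx' h).1

lemma sum_view_le (P : Finset ℕ) (Y : Finset TriCell) : ∑ l ∈ P, (view l Y).card ≤ Y.card := by
  rw [← Finset.card_sigma]
  apply Finset.card_le_card_of_injOn (fun q => sh q.1 q.2)
  · rintro ⟨l, p⟩ h
    simp only [Finset.coe_sigma, Set.mem_sigma_iff, Finset.mem_coe, mem_view] at h
    exact h.2.2
  · rintro ⟨l, p⟩ h ⟨l', p'⟩ h' he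
    simp only [Finset.coe_sigma, Set.mem_sigma_iff, Finset.mem_coe, mem_view] at h h'
    obtain ⟨rfl, rfl⟩ := sh_inj h.2.1 h'.2.1 he
    rfl

lemma win_of_loc_zero (i : ℕ) (M B : Finset TriCell) (h : Loc 0 (view i M) (view i B)) :
    WinIn 2 3 1 M B := by
  classical
  obtain ⟨c, h1, h2, h3⟩ := h
  have himg : ∀ p ∈ dstar (c.1 + 20 * (i : ℤ), c.2), ∃ q ∈ dstar c, sh i q = p := by
    intro p hp
    simp only [dstar, Finset.mem_insert, Finset.mem_singleton] at hp
    rcases hp with rfl | rfl | rfl | rfl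
    · exact ⟨(c.1, c.2, 0), by simp [dstar], rfl⟩
    · exact ⟨(c.1, c.2, 1), by simp [dstar], rfl⟩
    · exact ⟨(c.1 + 1, c.2, 0), by simp [dstar], by simp [sh]; ring⟩
    · exact ⟨(c.1, c.2 + 1, 0), by simp [dstar], rfl⟩
  have hsub : ∀ p ∈ dstar (c.1 + 20 * (i : ℤ), c.2) \ M, ∃ q ∈ dstar c \ view i M, sh i q = p := by
    intro p hp
    rw [Finset.mem_sdiff] at hp
    obtain ⟨q, hq, rfl⟩ := himg p hp.1
    refine ⟨q, ?_, rfl⟩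
    rw [Finset.mem_sdiff, mem_view]
    exact ⟨hq, fun h => hp.2 h.2⟩
  apply win_one 2 3 M B (c.1 + 20 * (i : ℤ), c.2)
  · refine le_trans (le_trans (Finset.card_le_card (t := (dstar c \ view i M).image (sh i)) ?_)
      Finset.card_image_le) h2
    intro p hp
    rw [Finset.mem_image]
    exact hsub p hp
  · rw [Finset.disjoint_left]
    intro p hp hpB
    obtain ⟨q, hq, rfl⟩ := hsub p hp
    exact Finset.disjoint_left.mp h3 hq
      (mem_view.mpr ⟨h1 (Finset.mem_sdiff.mp hq).1, hpB⟩)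

open Classical in
/-- How many further breaker marks destroy `Loc k`, truncated at two. -/
noncomputable def wt (k : ℕ) (m b : Finset TriCell) : ℕ :=
  if ∀ y, Loc k m (insert y b) then 2 else if Loc k m b then 1 else 0

lemma wt_le (k : ℕ) (m b : Finset TriCell) : wt k m b ≤ 2 := by
  unfold wt; split_ifs <;> omega

lemma wt_not (k : ℕ) (m b : Finset TriCell) (h : ¬ Loc k m b) : wt k m b = 0 := by
  unfold wt
  rw [if_neg, if_neg h]
  intro h'
  exact h ((h' (0, 0, 0)).anti (Finset.subset_insert _ _))

lemma wt_drop (k : ℕ) (m b Y : Finset TriCell) : wt k m b ≤ wt k m (b ∪ Y) + Y.card := by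
  classical
  rcases Nat.lt_or_ge Y.card 2 with hY | hY
  · have hc : Y.card = 0 ∨ Y.card = 1 := by omega
    rcases hc with hc | hc
    · obtain rfl := Finset.card_eq_zero.mp hc
      simp
    · obtain ⟨y, rfl⟩ := Finset.card_eq_one.mp hc
      have hu : b ∪ {y} = insert y b := by
        ext p; simp
      rw [hu, hc]
      by_cases h : ∀ y, Loc k m (insert y b)
      · have h1 : 1 ≤ wt k m (insert y b) := by
          unfold wt
          split_ifs with h2 h3
          · omega
          · omega
          · exact absurd (h y) h3
        have := wt_le k m b
        omega
      · have : wt k m b ≤ 1 := by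
          unfold wt
          rw [if_neg h]
          split_ifs <;> omega
        omega
  · have := wt_le k m b
    omega

lemma inner (k N n : ℕ)
    (hk : ∀ (M B : Finset TriCell) (S : Finset ℕ), N ≤ S.card →
      (∀ i ∈ S, Loc k (view i M) (view i B)) → WinIn 2 3 n M B) :
    ∀ (r : ℕ) (M B : Finset TriCell) (S P : Finset ℕ), Disjoint S P → 5 * r ≤ S.card →
      (∀ i ∈ S, Loc (k + 1) (view i M) (view i B)) →
      2 * N ≤ (∑ l ∈ P, wt k (view l M) (view l B)) + r → WinIn 2 3 (n + r) M B := by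
  classical
  intro r
  induction r with
  | zero =>
    intro M B S P _ _ _ hw
    apply hk M B (P.filter (fun l => Loc k (view l M) (view l B)))
    · have : ∑ l ∈ P, wt k (view l M) (view l B) ≤
          ∑ l ∈ P, if Loc k (view l M) (view l B) then 2 else 0 := by
        apply Finset.sum_le_sum
        intro l _
        split_ifs with h
        · exact wt_le _ _ _
        · exact (wt_not _ _ _ h).le
      rw [← Finset.sum_filter, Finset.sum_const, smul_eq_mul] at this
      omega
    · intro i hi
      exact (Finset.mem_filter.mp hi).2
  | succ r ih =>
    intro M B S P hSP hS hL hw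
    obtain ⟨i, hi, j, hj, hij⟩ := Finset.one_lt_card.mp (show 1 < S.card by omega)
    obtain ⟨x, hx, hxm, hxb, hxy⟩ := hL i hi
    obtain ⟨x', hx', hxm', hxb', hxy'⟩ := hL j hj
    have hne : sh i x ≠ sh j x' := fun h => hij (sh_inj hx hx' h).1
    refine ⟨{sh i x, sh j x'}, Finset.card_pair hne, ?_, fun Y hY _ => ?_⟩
    · rw [Finset.disjoint_left]
      intro p hp hp'
      simp only [Finset.mem_insert, Finset.mem_singleton] at hp
      simp only [mem_view, not_and] at hxm hxb hxm' hxb'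
      rw [Finset.mem_union] at hp'
      rcases hp with rfl | rfl <;> rcases hp' with hp' | hp'
      · exact hxm hx hp'
      · exact hxb hx hp'
      · exact hxm' hx' hp'
      · exact hxb' hx' hp'
    · have hiP : i ∉ P := Finset.disjoint_left.mp hSP hi
      have hjP : j ∉ P := Finset.disjoint_left.mp hSP hj
      apply ih _ _ (S.filter (fun l => (l ≠ i ∧ l ≠ j) ∧ view l Y = ∅)) (insert i (insert j P))
      · rw [Finset.disjoint_left]
        intro l hl hl'
        simp only [Finset.mem_filter, Finset.mem_insert] at hl hl'
        rcases hl' with h | h | h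
        · exact hl.2.1.1 h
        · exact hl.2.1.2 h
        · exact Finset.disjoint_left.mp hSP hl.1 h
      · have hsub : S ⊆ S.filter (fun l => (l ≠ i ∧ l ≠ j) ∧ view l Y = ∅) ∪
            ({i, j} ∪ S.filter (fun l => view l Y ≠ ∅)) := by
          intro l hl
          simp only [Finset.mem_union, Finset.mem_filter, Finset.mem_insert,
            Finset.mem_singleton]
          tauto
        have h1 := Finset.card_le_card hsub
        have h2 := Finset.card_union_le
          (S.filter (fun l => (l ≠ i ∧ l ≠ j) ∧ view l Y = ∅))
          ({i, j} ∪ S.filter (fun l => view l Y ≠ ∅))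
        have h3 := Finset.card_union_le {i, j} (S.filter (fun l => view l Y ≠ ∅))
        have h4 : ({i, j} : Finset ℕ).card = 2 := Finset.card_pair hij
        have h5 : (S.filter (fun l => view l Y ≠ ∅)).card ≤ 3 := by
          rw [← hY]
          refine le_trans ?_ (sum_view_le (S.filter (fun l => view l Y ≠ ∅)) Y)
          rw [Finset.card_eq_sum_ones]
          apply Finset.sum_le_sum
          intro l hl
          exact Finset.card_pos.mpr (Finset.nonempty_iff_ne_empty.mpr (Finset.mem_filter.mp hl).2)
        omega
      · intro l hl
        simp only [Finset.mem_filter] at hl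
        rw [view_union, view_union, hl.2.2, view_pair_other hl.2.1.1 hl.2.1.2 hx hx',
          Finset.union_empty, Finset.union_empty]
        exact hL l hl.1
      · set M' := M ∪ {sh i x, sh j x'} with hM'
        have hVi : view i M' = insert x (view i M) := by
          rw [hM', view_union, view_pair hij hx hx', Finset.union_comm]; rfl
        have hVj : view j M' = insert x' (view j M) := by
          rw [hM', view_union, Finset.pair_comm, view_pair hij.symm hx' hx,
            Finset.union_comm]; rfl
        have hwi : wt k (view i M') (view i B) = 2 := by
          unfold wt; rw [if_pos]; rw [hVi]; exact hxy
        have hwj : wt k (view j M') (view j B) = 2 := by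
          unfold wt; rw [if_pos]; rw [hVj]; exact hxy'
        have hwP : ∑ l ∈ P, wt k (view l M') (view l B) = ∑ l ∈ P, wt k (view l M) (view l B) := by
          apply Finset.sum_congr rfl
          intro l hl
          rw [hM', view_union, view_pair_other (by rintro rfl; exact hiP hl)
            (by rintro rfl; exact hjP hl) hx hx', Finset.union_empty]
        have hold : ∑ l ∈ insert i (insert j P), wt k (view l M') (view l B) =
            2 + (2 + ∑ l ∈ P, wt k (view l M) (view l B)) := by
          rw [Finset.sum_insert, Finset.sum_insert hjP, hwi, hwj, hwP]
          rw [Finset.mem_insert]; tauto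
        have hdrop : ∑ l ∈ insert i (insert j P), wt k (view l M') (view l B) ≤
            ∑ l ∈ insert i (insert j P), wt k (view l M') (view l (B ∪ Y)) +
            ∑ l ∈ insert i (insert j P), (view l Y).card := by
          rw [← Finset.sum_add_distrib]
          apply Finset.sum_le_sum
          intro l _
          rw [view_union l B Y]
          exact wt_drop _ _ _ _
        have hYs := sum_view_le (insert i (insert j P)) Y
        omega

lemma outer (k : ℕ) : ∃ N n : ℕ, ∀ (M B : Finset TriCell) (S : Finset ℕ), N ≤ S.card →
    (∀ i ∈ S, Loc k (view i M) (view i B)) → WinIn 2 3 n M B := by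
  induction k with
  | zero =>
    refine ⟨1, 1, fun M B S hS h => ?_⟩
    obtain ⟨i, hi⟩ := Finset.card_pos.mp hS
    exact win_of_loc_zero i M B (h i hi)
  | succ k ih =>
    obtain ⟨N, n, hk⟩ := ih
    refine ⟨5 * (2 * N), n + 2 * N, fun M B S hS h => ?_⟩
    exact inner k N n hk (2 * N) M B S ∅ (by simp) hS h (by simp)

theorem win_2_3 : IsWinner T43 2 3 := by
  obtain ⟨N, n, h⟩ := outer 3
  apply isWinner_of_winIn 2 3 n
  apply h ∅ ∅ (Finset.range N) (by simp)
  intro i _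
  have : view i ∅ = ∅ := by simp [view]
  rw [this]
  exact loc_three

/-- `T₄,₃` has threshold sequence `(0, 3, 8, ∞)`: it is a `(1,0)`-winner, a `(1,1)`-loser,
a `(2,3)`-winner, a `(2,4)`-loser, a `(3,8)`-winner, a `(3,9)`-loser, and an
`(n,b)`-winner for every `n ≥ 4` and every `b`. -/
theorem T43_threshold :
    IsWinner T43 1 0 ∧ ¬ IsWinner T43 1 1 ∧
    IsWinner T43 2 3 ∧ ¬ IsWinner T43 2 4 ∧
    IsWinner T43 3 8 ∧ ¬ IsWinner T43 3 9 ∧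
    ∀ n b : ℕ, 4 ≤ n → IsWinner T43 n b := by
  exact ⟨win_1_0, loser 1 (by norm_num), win_2_3, loser 2 (by norm_num), win_3_8,
    loser 3 (by norm_num), win_four⟩
end
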